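/- arXiv:1610.03587 — 5 statements merged into one kernel-verified Lean document; each statement's English description precedes it below -/
import Mathlib

section
/- Let q be a prime power and let d, m be positive integers with m ≥ 2, d | q−1 and gcd(m,d) = 1. Then there exist sets K₀,…,K_{d−1} and a ((q^m−1)/d, (q−1)/d, {K₀,…,K_{d−1}}, 1)-BNCRDP of size d(q^{m−1}−1)/(q−1) over Z_{(q^m−1)/d}, say {A₀′,…,A_{d−1}′}, such that for each j the set of all elements of the base blocks of A_j′ together with {0} is a complete system of representatives for the cosets of ((q^m−1)/(q−1))·Z_{(q^m−1)/d} in Z_{(q^m−1)/d}. -/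
open scoped Classical

/-- The multiset of all elements of the base blocks of a family `B`. -/
def blockElems {n u : ℕ} (B : Fin u → Finset (ZMod n)) : Multiset (ZMod n) :=
  ∑ i : Fin u, (B i).val

/-- The multiset of internal differences `Δ(B)`. -/
def deltaList {n u : ℕ} (B : Fin u → Finset (ZMod n)) : Multiset (ZMod n) :=
  ∑ i : Fin u, (((B i) ×ˢ (B i)).filter (fun p => p.1 ≠ p.2)).val.map (fun p => p.1 - p.2)

/-- The multiset of external differences `Δ_E(B, B')`. -/
def deltaE {n u : ℕ} (B B' : Fin u → Finset (ZMod n)) : Multiset (ZMod n) :=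
  ∑ i : Fin u, ((B i) ×ˢ (B' i)).val.map (fun p => p.2 - p.1)

/-- `x` is a multiple of `d` in `ZMod n`, i.e. `x ∈ d·Z_n`. -/
def inSub (n d : ℕ) (x : ZMod n) : Prop := ∃ y : ZMod n, x = (d : ZMod n) * y

/-- The multiset `T` is a complete system of representatives for the cosets of
`d·Z_n` in `Z_n`: each coset contains exactly one element of `T`
(counted with multiplicity). -/
def IsCSR (n d : ℕ) (T : Multiset (ZMod n)) : Prop :=
  ∀ x : ZMod n, Multiset.card (T.filter (fun t => inSub n d (x - t))) = 1

/-- `B` is an `(n, K, λ)`-CDP. -/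
def IsCDP (n u lam : ℕ) (K : Set ℕ) (B : Fin u → Finset (ZMod n)) : Prop :=
  (∀ i, (B i).card ∈ K) ∧ ∀ x : ZMod n, x ≠ 0 → (deltaList B).count x ≤ lam

/-- `B` is an `(n, {K₀,…,K_{M−1}}, λ)`-BNCDP of size `u`. -/
def IsBNCDP (n M u lam : ℕ) (K : Fin M → Set ℕ)
    (B : Fin M → Fin u → Finset (ZMod n)) : Prop :=
  (∀ j, IsCDP n u lam (K j) (B j)) ∧
  ∀ j j' : Fin M, j ≠ j' → ∀ x : ZMod n, (deltaE (B j) (B j')).count x ≤ lam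

/-- `B` is an `(n, g, K, 1)`-CRDP (relative to the subgroup `H = (n/g)·Z_n` of order `g`). -/
def IsCRDP (n g u : ℕ) (K : Set ℕ) (B : Fin u → Finset (ZMod n)) : Prop :=
  (∀ i, (B i).card ∈ K) ∧
  (∀ x : ZMod n, inSub n (n / g) x → (deltaList B).count x = 0) ∧
  (∀ x : ZMod n, (deltaList B).count x ≤ 1)

/-- `B` is an `(n, g, {K₀,…,K_{M−1}}, 1)`-BNCRDP of size `u`. -/
def IsBNCRDP (n g M u : ℕ) (K : Fin M → Set ℕ)
    (B : Fin M → Fin u → Finset (ZMod n)) : Prop :=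
  (∀ j, IsCRDP n g u (K j) (B j)) ∧
  ∀ j j' : Fin M, j ≠ j' →
    (∀ x : ZMod n, inSub n (n / g) x → (deltaE (B j) (B j')).count x = 0) ∧
    (∀ x : ZMod n, (deltaE (B j) (B j')).count x ≤ 1)

theorem sum_card_filter_eq_card_sigma {ι α : Type*} [Fintype ι] (S : ι → Finset α)
    (P : α → Prop) [DecidablePred P] :
    ∑ i, Multiset.card ((S i).val.filter P) =
      (Finset.univ.sigma fun i => (S i).filter P).card := by
  rw [Finset.card_sigma]
  rfl

theorem count_sum_map_le_one {ι α β : Type*} [Fintype ι] [DecidableEq β]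
    (S : ι → Finset α) (f : α → β)
    (h : ∀ i j a b, a ∈ S i → b ∈ S j → f a = f b → i = j ∧ a = b) (x : β) :
    (∑ i, (S i).val.map f).count x ≤ 1 := by
  simp only [Multiset.count_sum', Multiset.count_map]
  rw [sum_card_filter_eq_card_sigma, Finset.card_le_one]
  rintro ⟨i, a⟩ ha ⟨j, b⟩ hb
  simp only [Finset.mem_sigma, Finset.mem_univ, Finset.mem_filter, true_and] at ha hb
  obtain ⟨rfl, rfl⟩ := h i j a b ha.1 hb.1 (ha.2.symm.trans hb.2)
  rfl

theorem count_sum_map_eq_zero {ι α β : Type*} [Fintype ι] [DecidableEq β]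
    (S : ι → Finset α) (f : α → β)
    (x : β) (h : ∀ i, ∀ a ∈ S i, f a ≠ x) : (∑ i, (S i).val.map f).count x = 0 := by
  simp only [Multiset.count_eq_zero, Multiset.mem_sum, Multiset.mem_map, not_exists, not_and,
    Finset.mem_val]
  exact fun i _ a ha => h i a ha

theorem isCSR_blockElems_add_zero {n u v : ℕ} (B : Fin u → Finset (ZMod n))
    (hpos : ∀ x, inSub n v x → ∀ i, ∀ a ∈ B i, ¬ inSub n v (x - a))
    (hex : ∀ x, ¬ inSub n v x → ∃ i, ∃ a ∈ B i, inSub n v (x - a))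
    (huniq : ∀ x i j a b, a ∈ B i → b ∈ B j → inSub n v (x - a) → inSub n v (x - b) →
      i = j ∧ a = b) :
    IsCSR n v (blockElems B + {0}) := by
  intro x
  have hsum : Multiset.card ((blockElems B).filter fun t => inSub n v (x - t)) =
      (Finset.univ.sigma fun i => (B i).filter fun t => inSub n v (x - t)).card := by
    rw [← sum_card_filter_eq_card_sigma, ← Multiset.countP_eq_card_filter]
    simp only [blockElems, ← Multiset.countP_eq_card_filter, ← Multiset.coe_countPAddMonoidHom,
      map_sum]
  rw [Multiset.filter_add, Multiset.card_add, hsum]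
  by_cases hx : inSub n v x
  · rw [Multiset.filter_singleton, if_pos (by simpa using hx), Multiset.card_singleton,
      Finset.card_eq_zero.2]
    ext ⟨i, a⟩
    simpa using hpos x hx i a
  · rw [Multiset.filter_singleton, if_neg (by simpa using hx), Multiset.empty_eq_zero,
      Multiset.card_zero, add_zero, Finset.card_eq_one]
    obtain ⟨i, a, ha, hxa⟩ := hex x hx
    refine ⟨⟨i, a⟩, ?_⟩
    ext ⟨j, b⟩
    simp only [Finset.mem_sigma, Finset.mem_univ, Finset.mem_filter, true_and,
      Finset.mem_singleton]
    constructor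
    · rintro ⟨hb, hxb⟩
      obtain ⟨rfl, rfl⟩ := huniq x j i b a hb ha hxb hxa
      rfl
    · rintro h
      cases h
      exact ⟨ha, hxa⟩

section AffineLines

variable (K : Type*) {F : Type*} [Field K] [Field F] [Algebra K F]

/-- The projection of `F` along the subfield `K`; its nonzero fibres are the affine lines with
direction `K` that avoid the origin. -/
def modBase : F →ₗ[K] F ⧸ Submodule.span K {(1 : F)} :=
  (Submodule.span K {(1 : F)}).mkQ

theorem modBase_eq_zero_iff {x : F} : modBase K x = 0 ↔ ∃ c : K, algebraMap K F c = x := by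
  simp [modBase, Submodule.mem_span_singleton, Algebra.algebraMap_eq_smul_one]

variable {K}

open scoped LinearAlgebra.Projectivization

theorem rep_eq_of_smul_eq {V : Type*} [AddCommGroup V] [Module K V] {p p' : ℙ K V} {c : K}
    (h : c • p.rep = p'.rep) : p' = p ∧ c = 1 := by
  have hp : p' = p := by
    rw [← p'.mk_rep, ← p.mk_rep, Projectivization.mk_eq_mk_iff']
    exact ⟨c, h⟩
  subst hp
  refine ⟨rfl, smul_left_injective K p'.rep_nonzero ?_⟩
  simpa using h

variable {p p' : ℙ K (F ⧸ Submodule.span K {(1 : F)})}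

theorem eq_of_algebraMap_mul_eq {c : K} {x y : F} (hx : modBase K x = p.rep)
    (hy : modBase K y = p'.rep) (h : algebraMap K F c * x = y) : p' = p ∧ x = y := by
  rw [← Algebra.smul_def] at h
  obtain ⟨hp, rfl⟩ := rep_eq_of_smul_eq (p := p) (p' := p') (c := c)
    (by rw [← hx, ← hy, ← h, map_smul])
  exact ⟨hp, by simpa using h⟩

theorem eq_of_mul_eq_mul {x y x' y' : F} (hx : modBase K x = p.rep) (hy : modBase K y = p.rep)
    (hx' : modBase K x' = p'.rep) (hy' : modBase K y' = p'.rep) (hxy : x ≠ y)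
    (h : x * y' = x' * y) : p = p' ∧ x = x' ∧ y = y' := by
  obtain ⟨s, hs⟩ := (modBase_eq_zero_iff K (x := x - y)).1 (by rw [map_sub, hx, hy, sub_self])
  obtain ⟨s', hs'⟩ := (modBase_eq_zero_iff K (x := x' - y')).1
    (by rw [map_sub, hx', hy', sub_self])
  have hs0 : algebraMap K F s ≠ 0 := by rw [hs]; exact sub_ne_zero.2 hxy
  have key : algebraMap K F (s' / s) * y = y' := by
    rw [map_div₀, div_mul_eq_mul_div, div_eq_iff hs0, hs, hs']
    linear_combination -h
  obtain ⟨hp, rfl⟩ := eq_of_algebraMap_mul_eq hy hy' key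
  have hy0 : y ≠ 0 := by
    rintro rfl
    exact p.rep_nonzero (by rw [← hy, map_zero])
  exact ⟨hp.symm, mul_right_cancel₀ hy0 h, rfl⟩

theorem card_projectivization_modBase [Finite K] [Finite F] {m : ℕ}
    (hF : Nat.card F = Nat.card K ^ m) :
    Nat.card (ℙ K (F ⧸ Submodule.span K {(1 : F)})) * (Nat.card K - 1) =
      Nat.card K ^ (m - 1) - 1 := by
  have hrank : Module.finrank K F = m := by
    rw [Module.natCard_eq_pow_finrank (K := K) (V := F)] at hF
    exact Nat.pow_right_injective Finite.one_lt_card hF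
  have h := Submodule.finrank_quotient_add_finrank (Submodule.span K {(1 : F)})
  rw [finrank_span_singleton one_ne_zero, hrank] at h
  rw [← Projectivization.card, Module.natCard_eq_pow_finrank (K := K), ← h, Nat.add_sub_cancel]

theorem pow_card_sub_one_eq_one_iff [Finite K] (x : F) :
    x ^ (Nat.card K - 1) = 1 ↔ x ≠ 0 ∧ ∃ c : K, algebraMap K F c = x := by
  have := Fintype.ofFinite K
  rw [Nat.card_eq_fintype_card]
  constructor
  · intro hx
    have hq : Fintype.card K - 1 ≠ 0 := (Nat.sub_pos_of_lt Fintype.one_lt_card).ne'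
    refine ⟨by rintro rfl; simp [hq] at hx, ?_⟩
    obtain ⟨h, hh⟩ := IsCyclic.exists_generator (α := Kˣ)
    have hprim : IsPrimitiveRoot (algebraMap K F h) (Fintype.card K - 1) := by
      refine IsPrimitiveRoot.map_of_injective (f := algebraMap K F) ?_ (algebraMap K F).injective
      rw [IsPrimitiveRoot.coe_units_iff, ← Fintype.card_units, ← Nat.card_eq_fintype_card,
        ← orderOf_eq_card_of_forall_mem_zpowers hh]
      exact IsPrimitiveRoot.orderOf h
    have : NeZero (Fintype.card K - 1) := ⟨hq⟩
    obtain ⟨i, -, hi⟩ := hprim.eq_pow_of_pow_eq_one hx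
    exact ⟨(h : K) ^ i, by rw [map_pow, hi]⟩
  · rintro ⟨hx, c, rfl⟩
    rw [← map_pow, FiniteField.pow_card_sub_one_eq_one c (by rintro rfl; simp at hx), map_one]

end AffineLines

/-- A cyclic group of order `d * (v * g)` with `v` coprime to `d` is covered by the translates of
its subgroup of order `v * g` by powers of an element of order dividing `d * g`. -/
theorem exists_zmod_hom_of_isCyclic {G : Type*} [CommGroup G] [Finite G] [IsCyclic G]
    {d v g : ℕ} (hG : Nat.card G = d * (v * g)) (hvd : v.Coprime d) :
    ∃ (w : G) (ψ : Multiplicative (ZMod (v * g)) →* G),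
      w ^ (d * g) = 1 ∧ Function.Injective ψ ∧
      (∀ s s' k k', w ^ s * ψ k = w ^ s' * ψ k' → s ≡ s' [MOD d]) ∧
      (∀ x s, ∃ i < d, ∃ k, w ^ (i + s) * ψ k = x) ∧
      ∀ x, inSub (v * g) v x ↔ ψ (.ofAdd x) ^ (d * g) = 1 := by
  obtain ⟨γ, hγ⟩ := IsCyclic.exists_generator (α := G)
  have hord : orderOf γ = d * (v * g) := by rw [orderOf_eq_card_of_forall_mem_zpowers hγ, hG]
  have hpos : 0 < d * (v * g) := hG ▸ Nat.card_pos
  have hd : 0 < d := Nat.pos_of_mul_pos_right hpos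
  have hvg : 0 < v * g := Nat.pos_of_mul_pos_left hpos
  have hg : 0 < g := Nat.pos_of_mul_pos_left hvg
  have hone (z : ℤ) : γ ^ z = 1 ↔ ((d * (v * g) : ℕ) : ℤ) ∣ z := by
    rw [← hord, orderOf_dvd_iff_zpow_eq_one]
  let f : ℤ →+ Additive G := zmultiplesHom (Additive G) (.ofMul (γ ^ d))
  have hf (z : ℤ) : (f z).toMul = γ ^ (d * z : ℤ) := by simp [f, zpow_mul]
  have hf0 : f (v * g : ℕ) = 0 := by
    apply Additive.toMul.injective
    rw [hf, toMul_zero, hone]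
    push_cast
    rfl
  let ψ : Multiplicative (ZMod (v * g)) →* G := (ZMod.lift (v * g) ⟨f, hf0⟩).toMultiplicativeLeft
  have hψ (z : ℤ) : ψ (.ofAdd (z : ZMod (v * g))) = γ ^ (d * z : ℤ) := by
    rw [← hf]
    exact congrArg Additive.toMul (ZMod.lift_coe _ ⟨f, hf0⟩ z)
  have hrep (k : Multiplicative (ZMod (v * g))) : ∃ z : ℤ, .ofAdd (z : ZMod (v * g)) = k :=
    ⟨(k.toAdd).cast, congrArg Multiplicative.ofAdd (ZMod.intCast_zmod_cast _)⟩
  have hcop : IsCoprime (v : ℤ) (d : ℤ) := Nat.isCoprime_iff_coprime.2 hvd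
  refine ⟨γ ^ v, ψ, ?_, ?_, ?_, ?_, ?_⟩
  · rw [← pow_mul, ← orderOf_dvd_iff_pow_eq_one, hord]
    exact dvd_of_eq (by ring)
  · rw [injective_iff_map_eq_one]
    intro k hk
    obtain ⟨z, rfl⟩ := hrep k
    rw [hψ, hone, Nat.cast_mul] at hk
    have := Int.dvd_of_mul_dvd_mul_left (by exact_mod_cast hd.ne') hk
    rw [(ZMod.intCast_zmod_eq_zero_iff_dvd z (v * g)).2 this]
    rfl
  · intro s s' k k' h
    obtain ⟨z, rfl⟩ := hrep k
    obtain ⟨z', rfl⟩ := hrep k'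
    rw [hψ, hψ, ← pow_mul, ← pow_mul, ← zpow_natCast, ← zpow_natCast, ← zpow_add, ← zpow_add,
      zpow_eq_zpow_iff_modEq, hord] at h
    have h1 : (d : ℤ) ∣ v * (s' - s) := by
      have := (Dvd.intro _ (by push_cast; rfl) : (d : ℤ) ∣ ((d * (v * g) : ℕ) : ℤ)).trans h.dvd
      have h2 : (v : ℤ) * (s' - s) = ((v * s' : ℕ) + d * z' - ((v * s : ℕ) + d * z) : ℤ)
          + d * (z - z') := by push_cast; ring
      rw [h2]
      exact dvd_add this (dvd_mul_right _ _)
    exact (Nat.modEq_iff_dvd).2 (hcop.symm.dvd_of_dvd_mul_left h1)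
  · intro x s
    obtain ⟨z, rfl⟩ := hγ x
    obtain ⟨a, b, hab⟩ := hcop
    have hd' : (0 : ℤ) < d := by exact_mod_cast hd
    have hi0 := Int.emod_nonneg (a * z - s) hd'.ne'
    have hi1 := Int.emod_lt_of_pos (a * z - s) hd'
    have hdiv := Int.emod_add_mul_ediv (a * z - s) d
    refine ⟨((a * z - s) % d).toNat, by omega,
      .ofAdd (((b * z + v * ((a * z - s) / d) : ℤ)) : ZMod (v * g)), ?_⟩
    rw [hψ, ← pow_mul, ← zpow_natCast, ← zpow_add]
    congr 1
    rw [Nat.cast_mul, Nat.cast_add, Int.toNat_of_nonneg hi0]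
    linear_combination z * hab + v * hdiv
  · intro x
    constructor
    · rintro ⟨y, rfl⟩
      obtain ⟨z, hz⟩ := hrep (.ofAdd y)
      obtain rfl : (z : ZMod (v * g)) = y := hz
      have : ((v : ZMod (v * g)) * (z : ZMod (v * g))) = ((v * z : ℤ) : ZMod (v * g)) := by
        push_cast; rfl
      rw [this, hψ, ← zpow_natCast, ← zpow_mul, hone]
      exact ⟨d * z, by push_cast; ring⟩
    · intro h
      obtain ⟨z, hz⟩ := hrep (.ofAdd x)
      obtain rfl : (z : ZMod (v * g)) = x := hz
      rw [hψ, ← zpow_natCast, ← zpow_mul, hone] at h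
      have h1 : ((d * g : ℕ) : ℤ) * v ∣ ((d * g : ℕ) : ℤ) * (d * z) := by
        convert h using 1 <;> push_cast <;> ring
      have h2 := Int.dvd_of_mul_dvd_mul_left (by exact_mod_cast (Nat.mul_pos hd hg).ne') h1
      obtain ⟨y, rfl⟩ := hcop.dvd_of_dvd_mul_left h2
      exact ⟨(y : ZMod (v * g)), by push_cast; rfl⟩

theorem exists_finite_field_extension {q m : ℕ} (hq : IsPrimePow q) (hm : m ≠ 0) :
    ∃ (K F : Type) (_ : Field K) (_ : Field F) (_ : Finite F) (_ : Algebra K F),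
      Nat.card K = q ∧ Nat.card F = q ^ m := by
  obtain ⟨p, k, hp, hk, rfl⟩ := (isPrimePow_nat_iff _).1 hq
  have : Fact p.Prime := ⟨hp⟩
  have : NeZero m := ⟨hm⟩
  have hK := GaloisField.card p k hk.ne'
  exact ⟨GaloisField p k, FiniteField.Extension (GaloisField p k) p m, inferInstance,
    inferInstance, inferInstance, inferInstance, hK,
    (FiniteField.natCard_extension (GaloisField p k) p m).trans (by rw [hK])⟩

open scoped LinearAlgebra.Projectivization

/-- Splitting the affine lines `modBase K = p.rep` into `d` cyclotomic pieces each gives a balanced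
nested family relative to the subgroup of order `g`. -/
theorem exists_isBNCRDP_isCSR {K F : Type*} [Field K] [Field F] [Finite F] [Algebra K F]
    {d v g u : ℕ} (hK : Nat.card K - 1 = d * g) (hF : Nat.card F - 1 = d * (v * g))
    (hvd : v.Coprime d)
    (hu : Nat.card (ℙ K (F ⧸ Submodule.span K {(1 : F)})) * d = u) :
    ∃ A : Fin d → Fin u → Finset (ZMod (v * g)),
      IsBNCRDP (v * g) g d u (fun _ => Set.univ) A ∧
      ∀ j, IsCSR (v * g) v (blockElems (A j) + {0}) := by
  have : Finite K := Finite.of_injective _ (algebraMap K F).injective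
  have : Finite (F ⧸ Submodule.span K {(1 : F)}) :=
    Finite.of_surjective _ (Submodule.mkQ_surjective _)
  have hG : Nat.card Fˣ = d * (v * g) := by rw [Nat.card_units, hF]
  obtain ⟨w, ψ, hw, hψ, hmod, hsurj, hsub⟩ := exists_zmod_hom_of_isCyclic hG hvd
  have hpos : 0 < d * (v * g) := hG ▸ Nat.card_pos
  have hvg : 0 < v * g := Nat.pos_of_mul_pos_left hpos
  have hg : 0 < g := Nat.pos_of_mul_pos_left hvg
  have : NeZero (v * g) := ⟨hvg.ne'⟩
  have hbase (x : Fˣ) : x ^ (d * g) = 1 ↔ ∃ c : K, algebraMap K F c = x := by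
    rw [← hK, ← Units.val_inj, Units.val_pow_eq_pow_val, Units.val_one,
      pow_card_sub_one_eq_one_iff (K := K)]
    simp
  let P (s : ℕ) (k : ZMod (v * g)) : Fˣ := w ^ s * ψ (.ofAdd k)
  have hPinj {s s' : ℕ} {k k' : ZMod (v * g)} (h : P s k = P s' k') : s ≡ s' [MOD d] :=
    hmod _ _ _ _ h
  have hPinj' {s : ℕ} {k k' : ZMod (v * g)} (h : P s k = P s k') : k = k' :=
    Multiplicative.ofAdd.injective (hψ (mul_left_cancel h))
  have hidx {i i' j : ℕ} (hi : i < d) (hi' : i' < d) {k k' : ZMod (v * g)}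
      (h : P (i + j) k = P (i' + j) k') : i = i' ∧ k = k' := by
    obtain rfl := (Nat.ModEq.add_right_cancel' j (hPinj h)).eq_of_lt_of_lt hi hi'
    exact ⟨rfl, hPinj' h⟩
  have hPpow (s : ℕ) (k : ZMod (v * g)) : P s k ^ (d * g) = ψ (.ofAdd k) ^ (d * g) := by
    rw [mul_pow, pow_right_comm, hw, one_pow, one_mul]
  have hsubP (s s' : ℕ) (a b : ZMod (v * g)) (h : inSub (v * g) v (a - b)) :
      ∃ c : K, algebraMap K F c * P s b = P s' a := by
    obtain ⟨c, hc⟩ := (hbase (P s' a * (P s b)⁻¹)).1 (by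
      have h1 := (hsub _).1 h
      rw [ofAdd_sub, map_div, div_pow, div_eq_one] at h1
      rw [mul_pow, inv_pow, mul_inv_eq_one, hPpow, hPpow, h1])
    exact ⟨c, by rw [hc, ← Units.val_mul, inv_mul_cancel_right]⟩
  have hPsub (s s' : ℕ) (a b : ZMod (v * g)) (c : K)
      (h : algebraMap K F c * P s b = P s' a) : inSub (v * g) v (a - b) := by
    have h1 := (hbase (P s' a * (P s b)⁻¹)).2 ⟨c, by rw [Units.val_mul, ← h]; simp⟩
    rw [mul_pow, inv_pow, mul_inv_eq_one, hPpow, hPpow] at h1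
    rw [hsub, ofAdd_sub, map_div, div_pow, h1, div_self']
  have hPmul (s s' t t' : ℕ) (a b a' b' : ZMod (v * g)) (hst : s + t' = s' + t)
      (h : a - b = a' - b') : (P s a : F) * P t' b' = P s' a' * P t b := by
    rw [← Units.val_mul, ← Units.val_mul, Units.val_inj]
    have h1 : a + b' = a' + b := by linear_combination h
    simp only [P]
    rw [mul_mul_mul_comm, mul_mul_mul_comm (w ^ s'), ← pow_add, ← pow_add, ← map_mul ψ, ← map_mul ψ,
      hst, ← ofAdd_add, ← ofAdd_add, h1]
  have hcard : Nat.card (ℙ K (F ⧸ Submodule.span K {(1 : F)}) × Fin d) = u := by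
    rw [Nat.card_prod, Nat.card_fin, hu]
  let e : Fin u ≃ ℙ K (F ⧸ Submodule.span K {(1 : F)}) × Fin d :=
    (Finite.equivFinOfCardEq hcard).symm
  let A (j : Fin d) (r : Fin u) : Finset (ZMod (v * g)) :=
    Finset.univ.filter fun k => modBase K (P ((e r).2 + j) k : F) = (e r).1.rep
  have hA {j : Fin d} {r : Fin u} {k : ZMod (v * g)} :
      k ∈ A j r ↔ modBase K (P ((e r).2 + j) k : F) = (e r).1.rep := by simp [A]
  have hdiff {j j' : Fin d} {r r' : Fin u} {a b a' b' : ZMod (v * g)} (ha : a ∈ A j r)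
      (hb : b ∈ A j' r) (ha' : a' ∈ A j r') (hb' : b' ∈ A j' r')
      (hab : P ((e r).2 + j) a ≠ P ((e r).2 + j') b) (h : a - b = a' - b') :
      r = r' ∧ a = a' ∧ b = b' := by
    obtain ⟨hp, hx, hy⟩ := eq_of_mul_eq_mul (hA.1 ha) (hA.1 hb) (hA.1 ha') (hA.1 hb')
      (fun h => hab (Units.ext h)) (hPmul _ _ _ _ a b a' b' (by ring) h)
    obtain ⟨hi, hk⟩ := hidx (e r).2.2 (e r').2.2 (Units.ext hx)
    have hr : r = r' := e.injective (Prod.ext hp (Fin.ext hi))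
    subst hr
    exact ⟨rfl, hk, hPinj' (Units.ext hy)⟩
  have hnot {j j' : Fin d} {r : Fin u} {a b : ZMod (v * g)} (ha : a ∈ A j r)
      (hb : b ∈ A j' r) (hab : P ((e r).2 + j) a ≠ P ((e r).2 + j') b) :
      ¬ inSub (v * g) v (a - b) := by
    intro h
    obtain ⟨c, hc⟩ := hsubP ((e r).2 + j') ((e r).2 + j) a b h
    exact hab (Units.ext (eq_of_algebraMap_mul_eq (hA.1 hb) (hA.1 ha) hc).2.symm)
  have hne {j j' : Fin d} (hj : j ≠ j') (i : ℕ) (a b : ZMod (v * g)) :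
      P (i + j) a ≠ P (i + j') b := fun h =>
    hj (Fin.ext ((Nat.ModEq.add_left_cancel' i (hPinj h)).eq_of_lt_of_lt j.2 j'.2))
  refine ⟨A, ⟨fun j => ⟨fun _ => Set.mem_univ _, fun x hx => ?_, fun x => ?_⟩,
    fun j j' hj => ⟨fun x hx => ?_, fun x => ?_⟩⟩, fun j => ?_⟩
  · rw [Nat.mul_div_cancel _ hg] at hx
    refine count_sum_map_eq_zero _ _ _ ?_
    rintro r ⟨a, b⟩ hab rfl
    simp only [Finset.mem_filter, Finset.mem_product] at hab
    exact hnot hab.1.1 hab.1.2 (fun h => hab.2 (hPinj' h)) hx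
  · refine count_sum_map_le_one _ _ ?_ x
    rintro r r' ⟨a, b⟩ ⟨a', b'⟩ hab hab' h
    simp only [Finset.mem_filter, Finset.mem_product] at hab hab'
    obtain ⟨h1, h2, h3⟩ := hdiff hab.1.1 hab.1.2 hab'.1.1 hab'.1.2
      (fun h => hab.2 (hPinj' h)) h
    exact ⟨h1, Prod.ext h2 h3⟩
  · rw [Nat.mul_div_cancel _ hg] at hx
    refine count_sum_map_eq_zero _ _ _ ?_
    rintro r ⟨a, b⟩ hab rfl
    simp only [Finset.mem_product] at hab
    exact hnot hab.2 hab.1 (hne hj.symm _ _ _) hx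
  · refine count_sum_map_le_one _ _ ?_ x
    rintro r r' ⟨a, b⟩ ⟨a', b'⟩ hab hab' h
    simp only [Finset.mem_product] at hab hab'
    obtain ⟨h1, h2, h3⟩ := hdiff hab.2 hab.1 hab'.2 hab'.1 (hne hj.symm _ _ _) h
    exact ⟨h1, Prod.ext h3 h2⟩
  · refine isCSR_blockElems_add_zero _ ?_ ?_ ?_
    · intro x hx r a ha h
      obtain ⟨c, hc⟩ := (hbase _).1 ((hsub x).1 hx)
      obtain ⟨c', hc'⟩ := hsubP 0 ((e r).2 + j) a x (by
        obtain ⟨y, hy⟩ := h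
        exact ⟨-y, by rw [mul_neg, ← hy, neg_sub]⟩)
      refine (e r).1.rep_nonzero ?_
      rw [← hA.1 ha, modBase_eq_zero_iff]
      exact ⟨c' * c, by rw [map_mul, hc, ← hc']; simp [P]⟩
    · intro x hx
      have hX : modBase K (ψ (.ofAdd x) : F) ≠ 0 := by
        rw [Ne, modBase_eq_zero_iff, ← hbase, ← hsub]
        exact hx
      obtain ⟨c, hc⟩ := Projectivization.exists_smul_eq_mk_rep K _ hX
      set p := Projectivization.mk K _ hX
      obtain ⟨i, hi, k, hk⟩ := hsurj (Units.map (algebraMap K F).toMonoidHom c * ψ (.ofAdd x)) j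
      have hk' : (P (i + j) k.toAdd : F) = algebraMap K F c * ψ (.ofAdd x) :=
        congrArg Units.val hk
      refine ⟨e.symm (p, ⟨i, hi⟩), k.toAdd, ?_, ?_⟩
      · rw [hA, Equiv.apply_symm_apply]
        simp only
        rw [hk', ← Algebra.smul_def, map_smul, ← hc]
        rfl
      · refine hPsub (i + j) 0 x k.toAdd (c⁻¹ : Kˣ) ?_
        rw [hk', ← mul_assoc, ← map_mul, Units.inv_mul, map_one, one_mul]
        simp [P]
    · intro x r r' a b ha hb hxa hxb
      obtain ⟨c, hc⟩ := hsubP ((e r).2 + j) ((e r').2 + j) b a (by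
        obtain ⟨y, hy⟩ := hxa
        obtain ⟨z, hz⟩ := hxb
        exact ⟨y - z, by linear_combination hy - hz⟩)
      obtain ⟨hp, hx⟩ := eq_of_algebraMap_mul_eq (hA.1 ha) (hA.1 hb) hc
      obtain ⟨hi, hk⟩ := hidx (e r).2.2 (e r').2.2 (Units.ext hx)
      exact ⟨e.injective (Prod.ext hp.symm (Fin.ext hi)), hk⟩

/-- The repunit `(q ^ m - 1) / (q - 1)` is congruent to `m` modulo every divisor of `q - 1`. -/
theorem coprime_geom_sum_of_dvd {q d m : ℕ} (hq : 0 < q) (hdq : d ∣ q - 1)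
    (hgcd : Nat.gcd m d = 1) : (∑ i ∈ Finset.range m, q ^ i).Coprime d := by
  have h1 : q ≡ 1 [MOD d] := ((Nat.modEq_iff_dvd' hq).2 hdq).symm
  have h : ∑ i ∈ Finset.range m, q ^ i ≡ m [MOD d] := by
    simpa using Nat.ModEq.sum (s := Finset.range m) (fun i _ => h1.pow i)
  exact h.gcd_eq.trans hgcd

theorem stmt2 (q d m : ℕ) (hq : IsPrimePow q) (hd : 0 < d) (hm : 2 ≤ m)
    (hdq : d ∣ q - 1) (hgcd : Nat.gcd m d = 1) :
    ∃ K : Fin d → Set ℕ,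
    ∃ A : Fin d → Fin (d * (q ^ (m - 1) - 1) / (q - 1)) → Finset (ZMod ((q ^ m - 1) / d)),
      IsBNCRDP ((q ^ m - 1) / d) ((q - 1) / d) d (d * (q ^ (m - 1) - 1) / (q - 1)) K A ∧
      ∀ j, IsCSR ((q ^ m - 1) / d) ((q ^ m - 1) / (q - 1))
        (blockElems (A j) + ({0} : Multiset (ZMod ((q ^ m - 1) / d)))) := by

  have hq1 : 1 < q := hq.one_lt
  obtain ⟨g, hg⟩ := hdq
  obtain ⟨K, F, _, _, _, _, hK, hF⟩ := exists_finite_field_extension hq (m := m) (by omega)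
  have : Finite K := Finite.of_injective _ (algebraMap K F).injective
  obtain ⟨v, hv⟩ : ∃ v, v = ∑ i ∈ Finset.range m, q ^ i := ⟨_, rfl⟩
  have hvd : v.Coprime d := hv ▸ coprime_geom_sum_of_dvd hq1.le ⟨g, hg⟩ hgcd
  have hvq : v * (q - 1) = q ^ m - 1 := by
    rw [hv, Nat.geomSum_eq hq1, Nat.div_mul_cancel (Nat.sub_one_dvd_pow_sub_one q m)]
  have hqm : q ^ m - 1 = d * (v * g) := by rw [← hvq, hg]; ring
  have hn : (q ^ m - 1) / d = v * g := by rw [hqm, Nat.mul_div_cancel_left _ hd]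
  have hgd : (q - 1) / d = g := by rw [hg, Nat.mul_div_cancel_left _ hd]
  have hvv : (q ^ m - 1) / (q - 1) = v := by
    rw [← hvq, Nat.mul_div_cancel _ (Nat.sub_pos_of_lt hq1)]
  have hcard := card_projectivization_modBase (K := K) (F := F) (m := m) (by rw [hF, hK])
  rw [hK] at hcard
  have hu : d * (q ^ (m - 1) - 1) / (q - 1) =
      Nat.card (ℙ K (F ⧸ Submodule.span K {(1 : F)})) * d := by
    rw [← hcard, ← mul_assoc, Nat.mul_div_cancel _ (Nat.sub_pos_of_lt hq1), mul_comm]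
  rw [hn, hgd, hvv]
  exact ⟨_, exists_isBNCRDP_isCSR (K := K) (F := F) (by rw [hK, hg]) (by rw [hF, hqm]) hvd hu.symm⟩
end

section
/- Let q be a prime power and let d, m be positive integers with d | q−1, m ≥ 3 and gcd(m,d) = 1. Let w be an odd integer whose least prime factor is greater than q. Then there exists a strictly optimal (w(q^m−1)/d, d, (q−1)/d; (q^{m−1}−1+(q−1)/d)w)-FHS set; that is, there exists a set S of M = d FHSs of length n = w(q^m−1)/d over an alphabet of size l = (q^{m−1}−1+(q−1)/d)w such that H(S;L) ≤ ⌈Lλ/n⌉ for every L with 1 ≤ L ≤ n, where λ = (q−1)/d = ⌈(2InM−(I+1)Il)/((nM−1)M)⌉ with I = ⌊nM/l⌋. -/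
/-- Partial Hamming correlation `H_{X,Y}(τ; j | L)` of the frequency hopping
sequences `X, Y : ZMod n → F` for shift `τ`, window start `j` and window length `L`. -/
def partialHC {n : ℕ} {F : Type*} [DecidableEq F] (X Y : ZMod n → F)
    (τ j : ZMod n) (L : ℕ) : ℕ :=
  ∑ t ∈ Finset.range L, if X (j + (t : ZMod n)) = Y (j + (t : ZMod n) + τ) then 1 else 0

/-- The Peng–Fan bound value `⌈(2InM − (I+1)Il) / ((nM−1)M)⌉` where `I = ⌊nM/l⌋`. -/
def pengFanBound (n M l : ℕ) : ℤ :=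
  ⌈(((2 * (n * M / l) * n * M : ℕ) : ℚ) - (((n * M / l + 1) * (n * M / l) * l : ℕ) : ℚ))
    / ((((n * M : ℕ) : ℚ) - 1) * (M : ℚ))⌉

/-- There is a strictly optimal `(n, M, λ; l)`-FHS set (with respect to the Peng–Fan
bound): `λ` equals the Peng–Fan bound value and there are `M` pairwise distinct FHSs of
length `n` over an alphabet of size `l` whose maximum nontrivial partial Hamming
correlation satisfies `H(S; L) ≤ ⌈Lλ/n⌉` for every window length `1 ≤ L ≤ n`. -/
def IsStrictlyOptimalFHSSet (n M lam l : ℕ) : Prop :=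
  (lam : ℤ) = pengFanBound n M l ∧
  ∃ X : Fin M → (ZMod n → Fin l),
    (∀ a b : Fin M, a ≠ b → X a ≠ X b) ∧
    ∀ L : ℕ, 1 ≤ L → L ≤ n →
      (∀ a : Fin M, ∀ τ : ZMod n, τ ≠ 0 → ∀ j : ZMod n,
        (partialHC (X a) (X a) τ j L : ℤ) ≤ ⌈((L * lam : ℕ) : ℚ) / (n : ℚ)⌉) ∧
      (∀ a b : Fin M, a ≠ b → ∀ τ j : ZMod n,
        (partialHC (X a) (X b) τ j L : ℤ) ≤ ⌈((L * lam : ℕ) : ℚ) / (n : ℚ)⌉)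

section Counting

theorem card_le_ceil_of_pairwise_modEq {r L : ℕ} (hr : 0 < r) (s : Finset ℕ)
    (hs : ∀ t ∈ s, t < L) (hmod : ∀ t ∈ s, ∀ t' ∈ s, t ≡ t' [MOD r]) :
    (s.card : ℤ) ≤ ⌈(L : ℚ) / r⌉ := by
  have hr' : (0 : ℚ) < r := by exact_mod_cast hr
  have hinj : Set.InjOn (fun t => t / r) s := by
    intro t ht t' ht' h
    rw [← Nat.div_add_mod t r, ← Nat.div_add_mod t' r, hmod t ht t' ht', show t / r = t' / r from h]
  have hlt : ∀ t ∈ s, t / r < ⌈(L : ℚ) / r⌉₊ := by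
    intro t ht
    rw [Nat.lt_ceil]
    calc ((t / r : ℕ) : ℚ) ≤ (t : ℚ) / r := Nat.cast_div_le
      _ < (L : ℚ) / r := by
        have := hs t ht
        gcongr
  have hcard : s.card ≤ ⌈(L : ℚ) / r⌉₊ := by
    rw [← Finset.card_image_of_injOn hinj]
    calc (s.image fun t => t / r).card ≤ (Finset.range ⌈(L : ℚ) / r⌉₊).card := by
          apply Finset.card_le_card
          intro a ha
          obtain ⟨t, ht, rfl⟩ := Finset.mem_image.1 ha
          exact Finset.mem_range.2 (hlt t ht)
      _ = _ := Finset.card_range _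
  rw [← Int.natCast_ceil_eq_ceil (by positivity)]
  exact_mod_cast hcard

/-- A family of `n`-periodic sequences in which the coincidences at every nontrivial shift lie in a
single residue class modulo `n / lam` is a strictly optimal frequency hopping sequence set. -/
theorem isStrictlyOptimalFHSSet_of_modEq {n M lam l r : ℕ} {A : Type*}
    (hA : Nat.card A = l) (hl : 0 < l) (hn : n = lam * r) (hlam : 0 < lam) (hr : 1 < r)
    (hpf : (lam : ℤ) = pengFanBound n M l) (Y : Fin M → ℕ → A)
    (hper : ∀ a x, Y a (x % n) = Y a x)
    (hits : ∀ a b τ x x', (a ≠ b ∨ ¬ n ∣ τ) → Y a x = Y b (x + τ) → Y a x' = Y b (x' + τ) →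
      x ≡ x' [MOD r]) :
    IsStrictlyOptimalFHSSet n M lam l := by
  have hn0 : 0 < n := hn ▸ Nat.mul_pos hlam (by omega)
  have : NeZero n := ⟨hn0.ne'⟩
  have : Finite A := Nat.finite_of_card_ne_zero (by omega)
  let E : A ≃ Fin l := Finite.equivFinOfCardEq hA
  have key : ∀ a b : Fin M, ∀ τ : ZMod n, (a ≠ b ∨ τ ≠ 0) → ∀ (j : ZMod n) (L : ℕ),
      (partialHC (fun t => E (Y a t.val)) (fun t => E (Y b t.val)) τ j L : ℤ) ≤
        ⌈((L * lam : ℕ) : ℚ) / (n : ℚ)⌉ := by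
    intro a b τ hab j L
    have hq : ((L * lam : ℕ) : ℚ) / (n : ℚ) = (L : ℚ) / r := by
      have h1 : (lam : ℚ) ≠ 0 := by exact_mod_cast hlam.ne'
      have h2 : (r : ℚ) ≠ 0 := by exact_mod_cast (by omega : r ≠ 0)
      rw [hn]
      push_cast
      field_simp
    have hab' : a ≠ b ∨ ¬ n ∣ τ.val := by
      refine hab.imp_right fun h hdvd => h ?_
      rw [← ZMod.natCast_zmod_val τ]
      exact (ZMod.natCast_eq_zero_iff _ _).2 hdvd
    have hval : ∀ (c : Fin M) (x : ℕ), Y c ((x : ZMod n)).val = Y c x := by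
      intro c x
      rw [ZMod.val_natCast, hper]
    rw [hq, partialHC, ← Finset.card_filter]
    refine card_le_ceil_of_pairwise_modEq (by omega) _ (by simp +contextual) ?_
    have hmem : ∀ t : ℕ, E (Y a (j + (t : ZMod n)).val) = E (Y b (j + (t : ZMod n) + τ).val) →
        Y a (j.val + t) = Y b (j.val + t + τ.val) := by
      intro t ht
      have := E.injective ht
      rwa [show j + (t : ZMod n) = ((j.val + t : ℕ) : ZMod n) by simp,
        show ((j.val + t : ℕ) : ZMod n) + τ = ((j.val + t + τ.val : ℕ) : ZMod n) by simp,
        hval, hval] at this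
    intro t ht t' ht'
    exact Nat.ModEq.add_left_cancel' j.val (hits a b τ.val _ _ hab'
      (hmem t (Finset.mem_filter.1 ht).2) (hmem t' (Finset.mem_filter.1 ht').2))
  refine ⟨hpf, fun a t => E (Y a t.val), ?_, fun L _ _ =>
    ⟨fun a τ hτ j => key a a τ (Or.inr hτ) j L, fun a b hab τ j => key a b τ (Or.inl hab) j L⟩⟩
  intro a b hab h
  have heq : ∀ x : ℕ, Y a x = Y b (x + 0) := by
    intro x
    have := E.injective (congrFun h (x : ZMod n))
    rwa [ZMod.val_natCast, hper, hper] at this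
  have h01 := hits a b 0 0 1 (Or.inl hab) (heq 0) (heq 1)
  have := (Nat.modEq_iff_dvd' (Nat.zero_le 1)).1 h01
  have := Nat.le_of_dvd (by norm_num) this
  omega

end Counting

section Arithmetic

theorem pengFanBound_eq {q d m w e θ : ℕ} (hm : 3 ≤ m) (hw : 0 < w) (he : 0 < e)
    (hd : 0 < d) (hde : d * e = q - 1) (hθ : (q - 1) * θ = q ^ m - 1) :
    (e : ℤ) = pengFanBound (e * (w * θ)) d ((q ^ (m - 1) - 1 + e) * w) := by
  obtain ⟨p, rfl⟩ : ∃ p, q = p + 1 := ⟨q - 1, by have := Nat.mul_pos hd he; omega⟩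
  obtain ⟨k, rfl⟩ : ∃ k, m = k + 3 := ⟨m - 3, by omega⟩
  simp only [Nat.add_sub_cancel] at *
  have hp : 0 < p := hde ▸ Nat.mul_pos hd he
  have hep : e ≤ p := hde ▸ Nat.le_mul_of_pos_left e hd
  obtain ⟨R, hR⟩ : ∃ R, (p + 1) ^ (k + 2) = R + 1 :=
    ⟨(p + 1) ^ (k + 2) - 1, by have := Nat.pow_pos (n := k + 2) (show 0 < p + 1 by omega); omega⟩
  have hRp : p * p + 2 * p ≤ R := by
    have : (p + 1) ^ 2 ≤ (p + 1) ^ (k + 2) := Nat.pow_le_pow_right (by omega) (by omega)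
    nlinarith
  have hQ : (p + 1) ^ (k + 3) = (R + 1) * (p + 1) := by rw [← hR, ← pow_succ]
  have hnM : e * (w * θ) * d = w * (R * (p + 1) + p) := by
    have : e * (w * θ) * d = w * (p * θ) := by rw [← hde]; ring
    rw [this, hθ, hQ]
    congr 1
    have : (R + 1) * (p + 1) = R * (p + 1) + p + 1 := by ring
    omega
  have hsub : (p + 1) ^ (k + 3 - 1) - 1 = R := by
    rw [show k + 3 - 1 = k + 2 by omega, hR, Nat.add_sub_cancel]
  have hI : e * (w * θ) * d / ((R + e) * w) = p := by
    rw [hnM, mul_comm (R + e) w, Nat.mul_div_mul_left _ _ hw]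
    apply Nat.div_eq_of_lt_le
    · nlinarith
    · nlinarith
  have hmul : 2 * p * (e * (w * θ)) * d = 2 * p * (w * (R * (p + 1) + p)) := by
    rw [← hnM]; ring
  rw [pengFanBound, hsub, hI, hmul, hnM]
  symm
  have hw1 : (1 : ℚ) ≤ w := by exact_mod_cast hw
  have hd1 : (1 : ℚ) ≤ d := by exact_mod_cast hd
  have he1 : (1 : ℚ) ≤ e := by exact_mod_cast he
  have hp1 : (1 : ℚ) ≤ p := by exact_mod_cast hp
  have hep1 : (e : ℚ) ≤ p := by exact_mod_cast hep
  have hRp1 : (p : ℚ) * p + 2 * p ≤ R := by exact_mod_cast hRp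
  have hde1 : (d : ℚ) * e = p := by exact_mod_cast hde
  have hden : (0 : ℚ) < w * (R * (p + 1) + p) - 1 := by
    have h1 : (1 : ℚ) < R * (p + 1) + p := by nlinarith
    nlinarith
  have hden' : (0 : ℚ) < ((w : ℚ) * (R * (p + 1) + p) - 1) * d := by positivity
  rw [Int.ceil_eq_iff]
  push_cast
  constructor
  · rw [lt_div_iff₀ hden']
    have h1 : 0 < (w : ℚ) * (R * (p + 1) + p) + e - 1 - e * w * ((p + 1) * (e - 1) + 1) := by
      have h2 : (e : ℚ) * ((p + 1) * (e - 1) + 1) ≤ p * ((p + 1) * (p - 1) + 1) := by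
        gcongr
      have h3 : (p : ℚ) * ((p + 1) * (p - 1) + 1) < R * (p + 1) + p := by nlinarith
      nlinarith
    linear_combination mul_pos (zero_lt_one.trans_le hd1) h1 +
      (w : ℚ) * (2 * (R * (p + 1) + p) - (p + 1) * (R + e)) * hde1
  · rw [div_le_iff₀ hden']
    have h1 : 1 ≤ (w : ℚ) * ((p + 1) * (e - 1) + 1) := by nlinarith
    linear_combination (d : ℚ) * e * h1 -
      (w : ℚ) * (2 * (R * (p + 1) + p) - (p + 1) * (R + e)) * hde1

theorem dvd_of_modEq_of_ne {w p p' A B u : ℕ} (hp : p < w.minFac) (hp' : p' < w.minFac)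
    (hne : p ≠ p') (h : p * A ≡ p' * B [MOD w])
    (h' : p * (A + u) ≡ p' * (B + u) [MOD w]) : w ∣ u := by
  have hc : Nat.Coprime w ((p : ℤ) - p').natAbs :=
    Nat.coprime_of_lt_minFac (by omega) (by omega)
  refine hc.dvd_of_dvd_mul_left ?_
  have h1 : (w : ℤ) ∣ ((p : ℤ) - p') * u := by
    rw [show ((p : ℤ) - p') * u = ((p' * B : ℕ) - (p * A : ℕ)) -
      ((p' * (B + u) : ℕ) - (p * (A + u) : ℕ)) by push_cast; ring]
    exact dvd_sub (Nat.modEq_iff_dvd.1 h) (Nat.modEq_iff_dvd.1 h')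
  simpa [Int.natAbs_mul] using Int.natAbs_dvd_natAbs.2 h1

theorem dvd_of_mul_modEq_mul_add {w p A v : ℕ} (hp0 : 0 < p) (hp : p < w.minFac)
    (h : p * A ≡ p * (A + v) [MOD w]) : w ∣ v := by
  have hc : Nat.Coprime w p := Nat.coprime_of_lt_minFac hp0.ne' hp
  have h1 := Nat.ModEq.cancel_left_of_coprime hc h
  simpa using (Nat.modEq_iff_dvd' (Nat.le_add_right A v)).1 h1

end Arithmetic

section Label

variable {F : Type*} [Field F]

/-- The elements of a finite field outside a subfield `S` can be labelled so that labels are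
invariant under scaling by `S` and distinguish the elements of every coset of `S`. -/
theorem Subfield.exists_label [Finite F] (S : Subfield F) :
    ∃ lab : F → ℕ, (∀ y, 0 < lab y ∧ lab y ≤ Nat.card S) ∧
      (∀ c ∈ S, c ≠ 0 → ∀ y, y ∉ S → lab (c * y) = lab y) ∧
      ∀ y y', y ∉ S → y - y' ∈ S → lab y = lab y' → y = y' := by
  let σ : S ≃ Fin (Nat.card S) := Finite.equivFin S
  let R : F → Set F := fun y => {z | ∃ c ∈ S, c ≠ 0 ∧ y - c * z ∈ S}
  have hR : ∀ y, (R y).Nonempty := fun y => ⟨y, 1, S.one_mem, one_ne_zero, by simp [S.zero_mem]⟩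
  have hRadd : ∀ y y', y - y' ∈ S → R y = R y' := by
    intro y y' h
    ext z
    constructor
    · rintro ⟨c, hc, hc0, hz⟩
      exact ⟨c, hc, hc0, by simpa using S.sub_mem hz h⟩
    · rintro ⟨c, hc, hc0, hz⟩
      exact ⟨c, hc, hc0, by simpa using S.add_mem h hz⟩
  have hRmul : ∀ c ∈ S, c ≠ 0 → ∀ y, R (c * y) = R y := by
    intro c hc hc0 y
    ext z
    constructor
    · rintro ⟨b, hb, hb0, hz⟩
      refine ⟨c⁻¹ * b, S.mul_mem (S.inv_mem hc) hb, by positivity, ?_⟩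
      have := S.mul_mem (S.inv_mem hc) hz
      rwa [mul_sub, inv_mul_cancel_left₀ hc0, ← mul_assoc] at this
    · rintro ⟨b, hb, hb0, hz⟩
      refine ⟨c * b, S.mul_mem hc hb, mul_ne_zero hc0 hb0, ?_⟩
      have := S.mul_mem hc hz
      rwa [mul_sub, ← mul_assoc] at this
  let rep : Set F → F := fun T => Classical.epsilon (· ∈ T)
  have hrep : ∀ y, ∃ x : S, ∃ c ∈ S, c ≠ 0 ∧ y = c * (rep (R y) + x) := by
    intro y
    obtain ⟨c, hc, hc0, hz⟩ : rep (R y) ∈ R y := Classical.epsilon_spec (hR y)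
    refine ⟨⟨c⁻¹ * (y - c * rep (R y)), S.mul_mem (S.inv_mem hc) hz⟩, c, hc, hc0, ?_⟩
    field_simp
    ring
  choose x c hc hc0 hx using hrep
  have huniq : ∀ (z a a' b b' : F), a ∈ S → a' ∈ S → b ∈ S → b' ∈ S → a * (z + b) ∉ S →
      a * (z + b) - a' * (z + b') ∈ S → a = a' := by
    intro z a a' b b' ha ha' hb hb' hy h
    by_contra hne
    apply hy
    have hz : (a - a') * z ∈ S := by
      have := S.sub_mem (S.add_mem h (S.mul_mem ha' hb')) (S.mul_mem ha hb)
      convert this using 1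
      ring
    have hz' : z ∈ S := by
      have := S.mul_mem (S.inv_mem (S.sub_mem ha ha')) hz
      rwa [inv_mul_cancel_left₀ (sub_ne_zero.2 hne)] at this
    exact S.mul_mem ha (S.add_mem hz' hb)
  refine ⟨fun y => σ (x y) + 1, fun y => ⟨Nat.succ_pos _, (σ (x y)).2⟩, ?_, ?_⟩
  · intro a ha ha0 y hy
    have h1 := hx (a * y)
    rw [hRmul a ha ha0] at h1
    have h2 : a * y = (a * c y) * (rep (R y) + x y) := by
      rw [mul_assoc, ← hx y]
    have hay : a * y ∉ S := fun h => hy (by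
      have := S.mul_mem (S.inv_mem ha) h
      rwa [inv_mul_cancel_left₀ ha0] at this)
    have h3 : c (a * y) = a * c y := by
      refine huniq (rep (R y)) _ _ (x (a * y)) (x y) (hc _) (S.mul_mem ha (hc _)) (x _).2 (x _).2
        ?_ ?_
      · rwa [← h1]
      · rw [← h1, ← h2, sub_self]
        exact S.zero_mem
    have h4 : x (a * y) = x y := by
      rw [h1, h3] at h2
      exact Subtype.ext (add_left_cancel (mul_left_cancel₀ (mul_ne_zero ha0 (hc0 y)) h2))
    simp [h4]
  · intro y y' hy hyy h
    have h4 : x y = x y' := σ.injective (Fin.ext (by simpa using h))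
    have h1 := hx y'
    rw [← hRadd y y' hyy, ← h4] at h1
    have h2 := hx y
    have h3 : c y = c y' := by
      refine huniq (rep (R y)) _ _ (x y) (x y) (hc _) (hc _) (x _).2 (x _).2 ?_ ?_
      · rwa [← h2]
      · rwa [← h2, ← h1]
    rw [h2, h1, h3]

end Label

section Field

theorem exists_field_subfield_of_isPrimePow {q m : ℕ} (hq : IsPrimePow q) (hm : 0 < m) :
    ∃ (F : Type) (_ : Field F) (_ : Finite F) (S : Subfield F),
      Nat.card F = q ^ m ∧ Nat.card S = q := by
  obtain ⟨p, r, hp, hr, rfl⟩ := (isPrimePow_nat_iff _).1 hq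
  have : Fact p.Prime := ⟨hp⟩
  have : NeZero m := ⟨hm.ne'⟩
  have hK : Nat.card (GaloisField p r) = p ^ r := GaloisField.card p r hr.ne'
  refine ⟨FiniteField.Extension (GaloisField p r) p m, inferInstance, inferInstance,
    (algebraMap (GaloisField p r) (FiniteField.Extension (GaloisField p r) p m)).fieldRange, ?_, ?_⟩
  · rw [FiniteField.natCard_extension, hK]
  · rw [← hK]
    exact (Nat.card_congr (Equiv.ofInjective _ (algebraMap (GaloisField p r)
      (FiniteField.Extension (GaloisField p r) p m)).injective)).symm

variable {F : Type*} [Field F]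

theorem Subfield.mem_of_pow_card_sub_one_eq_one [Finite F] (S : Subfield F) {z : F}
    (hz : z ^ (Nat.card S - 1) = 1) : z ∈ S := by
  classical
  have := Fintype.ofFinite F
  have := Fintype.ofFinite S
  have hq : 1 < Nat.card S := Finite.one_lt_card
  let f : Sˣ → Fˣ := Units.map (S.subtype : S →* F)
  have hf : Function.Injective f := Units.map_injective S.subtype.injective
  have hsub : Finset.univ.image f ⊆
      Finset.univ.filter (fun u : Fˣ => u ^ (Nat.card S - 1) = 1) := by
    intro u hu
    obtain ⟨v, -, rfl⟩ := Finset.mem_image.1 hu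
    have hv : v ^ (Nat.card S - 1) = 1 := by
      rw [← Nat.card_units]
      exact pow_card_eq_one'
    simp only [Finset.mem_filter, Finset.mem_univ, true_and, f]
    rw [← map_pow, hv, map_one]
  have heq := Finset.eq_of_subset_of_card_le hsub (by
    rw [Finset.card_image_of_injective _ hf, Finset.card_univ, ← Nat.card_eq_fintype_card,
      Nat.card_units]
    exact IsCyclic.card_pow_eq_one_le (by omega))
  have hz0 : z ≠ 0 := by
    rintro rfl
    rw [zero_pow (by omega)] at hz
    exact zero_ne_one hz
  have hmem : Units.mk0 z hz0 ∈ Finset.univ.image f := by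
    rw [heq]
    simp only [Finset.mem_filter, Finset.mem_univ, true_and, Units.ext_iff]
    exact hz
  obtain ⟨v, -, hv⟩ := Finset.mem_image.1 hmem
  have := congrArg Units.val hv
  simp only [Units.val_mk0] at this
  rw [← this]
  exact (v : S).2

theorem exists_generator_mem_subfield_iff [Finite F] (S : Subfield F) {θ : ℕ}
    (hθ : (Nat.card S - 1) * θ = Nat.card F - 1) :
    ∃ g : F, g ≠ 0 ∧ (∀ k, g ^ k ∈ S ↔ θ ∣ k) ∧ orderOf g = Nat.card F - 1 := by
  have hq : 1 < Nat.card S := Finite.one_lt_card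
  obtain ⟨u, hu⟩ := IsCyclic.exists_generator (α := Fˣ)
  have hord : orderOf (u : F) = Nat.card F - 1 := by
    rw [orderOf_units, orderOf_eq_card_of_forall_mem_zpowers hu, Nat.card_units]
  refine ⟨u, u.ne_zero, fun k => ⟨fun h => ?_, ?_⟩, hord⟩
  · have hv : (⟨(u : F) ^ k, h⟩ : S) ^ (Nat.card S - 1) = 1 := by
      have hne : (⟨(u : F) ^ k, h⟩ : S) ≠ 0 := by
        intro h0
        exact pow_ne_zero k u.ne_zero (congrArg Subtype.val h0)
      have : (Units.mk0 _ hne) ^ (Nat.card S - 1) = 1 := by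
        rw [← Nat.card_units]
        exact pow_card_eq_one'
      simpa using congrArg Units.val this
    have hv' : (u : F) ^ (k * (Nat.card S - 1)) = 1 := by
      rw [pow_mul]
      exact congrArg Subtype.val hv
    have := orderOf_dvd_of_pow_eq_one hv'
    rw [hord, ← hθ, mul_comm] at this
    exact Nat.dvd_of_mul_dvd_mul_right (by omega) this
  · rintro ⟨k, rfl⟩
    apply S.mem_of_pow_card_sub_one_eq_one
    rw [← pow_mul]
    apply orderOf_dvd_iff_pow_eq_one.1
    rw [hord, ← hθ]
    exact ⟨k, by ring⟩

end Field

section Construction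

variable {F : Type*} [Field F] (S : Subfield F) (g : F) (lab : F → ℕ) (d e w θ : ℕ)

open Classical in
/-- The sequences of the construction. Powers of `g` outside `S` are sent to their coset modulo `S`,
powers of `g` in `S` to the position modulo `e`; a second coordinate in `ZMod w` separates the lifts
of a position. -/
noncomputable def hoppingSeq (a x : ℕ) :
    ({c : F ⧸ S.toSubring.toAddSubgroup // c ≠ 0} ⊕ ZMod e) × ZMod w :=
  if h : (QuotientAddGroup.mk (g ^ (a + d * x)) : F ⧸ S.toSubring.toAddSubgroup) = 0 then
    (Sum.inr ((x / θ : ℕ) : ZMod e), (((a + 1) * (x / θ) : ℕ) : ZMod w))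
  else (Sum.inl ⟨_, h⟩, ((lab (g ^ (a + d * x)) * (x / θ) : ℕ) : ZMod w))

variable {S g lab d e w θ}

theorem hoppingSeq_eq {a b x x' : ℕ}
    (h : hoppingSeq S g lab d e w θ a x = hoppingSeq S g lab d e w θ b x') :
    (g ^ (a + d * x) ∈ S ∧ g ^ (b + d * x') ∈ S ∧ x / θ ≡ x' / θ [MOD e] ∧
      (a + 1) * (x / θ) ≡ (b + 1) * (x' / θ) [MOD w]) ∨
    (g ^ (a + d * x) ∉ S ∧ g ^ (a + d * x) - g ^ (b + d * x') ∈ S ∧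
      lab (g ^ (a + d * x)) * (x / θ) ≡ lab (g ^ (b + d * x')) * (x' / θ) [MOD w]) := by
  have hmk : ∀ y : F, (QuotientAddGroup.mk y : F ⧸ S.toSubring.toAddSubgroup) = 0 ↔ y ∈ S :=
    fun y => QuotientAddGroup.eq_zero_iff y
  unfold hoppingSeq at h
  split_ifs at h with h1 h2 h2
  · simp only [Prod.mk.injEq, Sum.inr.injEq, ZMod.natCast_eq_natCast_iff] at h
    exact Or.inl ⟨(hmk _).1 h1, (hmk _).1 h2, h.1, h.2⟩
  · simp at h
  · simp at h
  · simp only [Prod.mk.injEq, Sum.inl.injEq, Subtype.mk.injEq, ZMod.natCast_eq_natCast_iff] at h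
    refine Or.inr ⟨fun h' => h1 ((hmk _).2 h'), ?_, h.2⟩
    have h3 := QuotientAddGroup.eq.1 h.1.symm
    have h4 : -g ^ (b + d * x') + g ^ (a + d * x) ∈ S := h3
    rwa [neg_add_eq_sub] at h4

theorem hoppingSeq_mod (hθ : 0 < θ) (hg : orderOf g = d * e * θ) (a x : ℕ) :
    hoppingSeq S g lab d e w θ a (x % (e * (w * θ))) = hoppingSeq S g lab d e w θ a x := by
  have key : ∀ y k : ℕ, hoppingSeq S g lab d e w θ a (y + e * (w * θ) * k) =
      hoppingSeq S g lab d e w θ a y := by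
    intro y k
    have h1 : g ^ (a + d * (y + e * (w * θ) * k)) = g ^ (a + d * y) := by
      rw [show a + d * (y + e * (w * θ) * k) = a + d * y + d * e * θ * (w * k) by ring,
        pow_add _ (a + d * y), pow_mul _ (d * e * θ), ← hg, pow_orderOf_eq_one, one_pow, mul_one]
    have h2 : (y + e * (w * θ) * k) / θ = y / θ + e * w * k := by
      rw [show e * (w * θ) * k = θ * (e * w * k) by ring, Nat.add_mul_div_left _ _ hθ]
    unfold hoppingSeq
    rw [h1, h2]
    simp
  conv_rhs => rw [← Nat.mod_add_div x (e * (w * θ)), key]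

theorem modEq_of_hoppingSeq_eq {q : ℕ} (hg0 : g ≠ 0) (hθ : 0 < θ)
    (hgS : ∀ k, g ^ k ∈ S ↔ θ ∣ k) (hg : orderOf g = d * e * θ) (hθd : θ.Coprime d)
    (hwe : w.Coprime e) (hqw : q < w.minFac) (hdq : d ≤ q)
    (hlab : ∀ y, 0 < lab y ∧ lab y ≤ q)
    (hmul : ∀ c ∈ S, c ≠ 0 → ∀ y, y ∉ S → lab (c * y) = lab y)
    (hinj : ∀ y y', y ∉ S → y - y' ∈ S → lab y = lab y' → y = y')
    {a b τ x x' : ℕ} (had : a < d) (hbd : b < d) (hab : a ≠ b ∨ ¬ e * (w * θ) ∣ τ)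
    (hx : hoppingSeq S g lab d e w θ a x = hoppingSeq S g lab d e w θ b (x + τ))
    (hx' : hoppingSeq S g lab d e w θ a x' = hoppingSeq S g lab d e w θ b (x' + τ)) :
    x ≡ x' [MOD w * θ] := by
  wlog hle : x ≤ x' generalizing x x'
  · exact (this hx' hx (by omega)).symm
  have hsplit : ∀ (c y v : ℕ), g ^ (c + d * (y + v)) = g ^ (d * v) * g ^ (c + d * y) := by
    intro c y v
    rw [← pow_add]
    congr 1
    ring
  have hdiv : ∀ y v : ℕ, (y + θ * v) / θ = y / θ + v := fun y v => Nat.add_mul_div_left _ _ hθ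
  have hne : g ^ (a + d * x) ≠ g ^ (b + d * (x + τ)) := by
    intro heq
    have h1 : a ≡ b + d * τ [MOD d * e * θ] := by
      have h1 : (Units.mk0 g hg0) ^ (a + d * x) = (Units.mk0 g hg0) ^ (b + d * (x + τ)) :=
        Units.ext (by simpa using heq)
      rw [pow_eq_pow_iff_modEq, ← orderOf_units, Units.val_mk0, hg] at h1
      exact Nat.ModEq.add_right_cancel' (d * x) (by convert h1 using 1; ring)
    have h2 : a = b := by
      have h3 : a ≡ b + d * τ [MOD d] := h1.of_dvd ⟨e * θ, by ring⟩
      have h4 : a % d = b % d := by simpa [Nat.ModEq] using h3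
      rwa [Nat.mod_eq_of_lt had, Nat.mod_eq_of_lt hbd] at h4
    subst h2
    have h3 : e * θ ∣ τ := by
      have := (Nat.modEq_iff_dvd' (Nat.le_add_right a _)).1 h1
      rw [Nat.add_sub_cancel_left, mul_assoc] at this
      exact Nat.dvd_of_mul_dvd_mul_left (by omega) this
    obtain ⟨v, rfl⟩ := h3
    have h4 : w ∣ e * v := by
      rw [mul_comm e θ, mul_assoc] at hx heq
      rcases hoppingSeq_eq hx with ⟨-, -, -, h⟩ | ⟨-, -, h⟩
      · rw [hdiv] at h
        exact dvd_of_mul_modEq_mul_add (by omega) (by omega) h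
      · rw [← heq, hdiv] at h
        exact dvd_of_mul_modEq_mul_add (hlab _).1 (lt_of_le_of_lt (hlab _).2 hqw) h
    obtain ⟨z, rfl⟩ := hwe.dvd_of_dvd_mul_left h4
    exact hab.elim (fun h => h rfl) fun h => h ⟨z, by ring⟩
  have hsub : ∀ y, hoppingSeq S g lab d e w θ a y = hoppingSeq S g lab d e w θ b (y + τ) →
      g ^ (a + d * y) - g ^ (b + d * (y + τ)) ∈ S := by
    intro y hy
    rcases hoppingSeq_eq hy with ⟨h1, h2, -⟩ | ⟨-, h, -⟩
    · exact S.sub_mem h1 h2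
    · exact h
  obtain ⟨t, rfl⟩ := Nat.exists_eq_add_of_le hle
  have hgt : g ^ (d * t) ∈ S := by
    have h2 := hsub _ hx'
    rw [show x + t + τ = x + τ + t by ring, hsplit a x t, hsplit b (x + τ) t, ← mul_sub] at h2
    have := S.mul_mem h2 (S.inv_mem (hsub _ hx))
    rwa [mul_inv_cancel_right₀ (sub_ne_zero.2 hne)] at this
  obtain ⟨u, rfl⟩ := hθd.dvd_of_dvd_mul_left ((hgS _).1 hgt)
  suffices hwu : w ∣ u by
    obtain ⟨z, rfl⟩ := hwu
    exact (Nat.modEq_iff_dvd' hle).2 ⟨z, by rw [Nat.add_sub_cancel_left]; ring⟩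
  have hgt0 : g ^ (d * (θ * u)) ≠ 0 := pow_ne_zero _ hg0
  have hback : ∀ y, g ^ (d * (θ * u)) * y ∈ S → y ∈ S := by
    intro y hy
    have := S.mul_mem (S.inv_mem hgt) hy
    rwa [inv_mul_cancel_left₀ hgt0] at this
  have hx'' := hoppingSeq_eq hx'
  rw [show x + θ * u + τ = x + τ + θ * u by ring, hsplit a x, hsplit b (x + τ), hdiv, hdiv] at hx''
  rcases hoppingSeq_eq hx with ⟨h1, h2, h3, h4⟩ | ⟨h1, h2, h3⟩
  · rcases hx'' with ⟨-, -, -, h4'⟩ | ⟨h1', -⟩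
    · rcases eq_or_ne a b with rfl | hne'
      · exfalso
        have hτ : g ^ (d * τ) ∈ S := by
          rw [hsplit] at h2
          have := S.mul_mem h2 (S.inv_mem h1)
          rwa [mul_inv_cancel_right₀ (pow_ne_zero _ hg0)] at this
        obtain ⟨v, rfl⟩ := hθd.dvd_of_dvd_mul_left ((hgS _).1 hτ)
        rw [hdiv] at h3 h4
        have hwv := dvd_of_mul_modEq_mul_add (by omega) (by omega) h4
        have hev : e ∣ v := by
          simpa using (Nat.modEq_iff_dvd' (Nat.le_add_right _ v)).1 h3
        obtain ⟨z, rfl⟩ := hwe.mul_dvd_of_dvd_of_dvd hwv hev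
        exact hab.elim (fun h => h rfl) fun h => h ⟨z, by ring⟩
      · exact dvd_of_modEq_of_ne (by omega) (by omega) (by omega) h4 h4'
    · exact absurd (S.mul_mem hgt h1) h1'
  · have hb : g ^ (b + d * (x + τ)) ∉ S := fun h => h1 (by simpa using S.add_mem h2 h)
    rcases hx'' with ⟨h1', -⟩ | ⟨-, -, h3'⟩
    · exact absurd (hback _ h1') h1
    · rw [hmul _ hgt hgt0 _ h1, hmul _ hgt hgt0 _ hb] at h3'
      exact dvd_of_modEq_of_ne (lt_of_le_of_lt (hlab _).2 hqw) (lt_of_le_of_lt (hlab _).2 hqw)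
        (fun h => hne (hinj _ _ h1 h2 h)) h3 h3'

theorem card_hopping_alphabet [Finite F] {q m : ℕ} (hq : 0 < q) (hm : 0 < m)
    (hF : Nat.card F = q ^ m) (hS : Nat.card S = q) (he : 0 < e) (hw : 0 < w) :
    Nat.card (({c : F ⧸ S.toSubring.toAddSubgroup // c ≠ 0} ⊕ ZMod e) × ZMod w) =
      (q ^ (m - 1) - 1 + e) * w := by
  have : NeZero e := ⟨he.ne'⟩
  have : NeZero w := ⟨hw.ne'⟩
  have hQ : Nat.card (F ⧸ S.toSubring.toAddSubgroup) = q ^ (m - 1) := by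
    have h := AddSubgroup.card_eq_card_quotient_mul_card_addSubgroup S.toSubring.toAddSubgroup
    have hS' : Nat.card S.toSubring.toAddSubgroup = q := hS
    rw [hF, hS', ← Nat.sub_add_cancel hm, pow_succ] at h
    simpa using (Nat.eq_of_mul_eq_mul_right hq h).symm
  have hne : Nat.card {c : F ⧸ S.toSubring.toAddSubgroup // c ≠ 0} = q ^ (m - 1) - 1 := by
    classical
    have := Fintype.ofFinite (F ⧸ S.toSubring.toAddSubgroup)
    rw [← hQ, Nat.card_eq_fintype_card, Nat.card_eq_fintype_card]
    exact Set.card_ne_eq 0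
  rw [Nat.card_prod, Nat.card_sum, hne, Nat.card_zmod, Nat.card_zmod]

end Construction

theorem stmt8 (q d m w : ℕ) (hq : IsPrimePow q) (hd : 0 < d) (hm : 3 ≤ m)
    (hdq : d ∣ q - 1) (hgcd : Nat.gcd m d = 1)
    (hw : Odd w) (hwq : q < w.minFac) :
    IsStrictlyOptimalFHSSet (w * (q ^ m - 1) / d) d ((q - 1) / d)
      ((q ^ (m - 1) - 1 + (q - 1) / d) * w) := by
  have hq1 : 1 < q := hq.one_lt
  have hw0 : 0 < w := hw.pos
  obtain ⟨e, hde⟩ := hdq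
  have he : 0 < e := Nat.pos_of_ne_zero fun h => by simp [h] at hde; omega
  have hdq : d ≤ q := by
    have := Nat.le_mul_of_pos_right d he
    omega
  have heq : e < q := by
    have := Nat.le_mul_of_pos_left e hd
    omega
  let θ := ∑ i ∈ Finset.range m, q ^ i
  have hθ : (q - 1) * θ = q ^ m - 1 := by
    have := geom_sum_mul_add (q - 1) m
    rw [Nat.sub_add_cancel hq1.le] at this
    rw [mul_comm]
    exact Nat.eq_sub_of_add_eq this
  have hθ1 : 1 ≤ θ := Nat.pos_of_ne_zero fun h => by
    have := Nat.one_lt_pow (show m ≠ 0 by omega) hq1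
    simp [h] at hθ
    omega
  have hθd : θ.Coprime d := by
    have h1 : q ≡ 1 [MOD d] := ((Nat.modEq_iff_dvd' hq1.le).2 ⟨e, hde⟩).symm
    have h2 : θ ≡ m [MOD d] := by
      have h3 : θ ≡ ∑ i ∈ Finset.range m, 1 [MOD d] := by
        simp only [θ, Nat.ModEq]
        rw [Finset.sum_nat_mod, Finset.sum_nat_mod (Finset.range m) d (fun _ => 1)]
        congr 1
        refine Finset.sum_congr rfl fun i _ => ?_
        simpa [Nat.ModEq] using h1.pow i
      simpa using h3
    rw [Nat.Coprime, h2.gcd_eq, hgcd]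
  have hwe : w.Coprime e := Nat.coprime_of_lt_minFac he.ne' (by omega)
  have hn : w * (q ^ m - 1) / d = e * (w * θ) := by
    rw [← hθ, hde, show w * (d * e * θ) = d * (e * (w * θ)) by ring, Nat.mul_div_cancel_left _ hd]
  have hlam : (q - 1) / d = e := by rw [hde, Nat.mul_div_cancel_left _ hd]
  rw [hn, hlam]
  obtain ⟨F, _, _, S, hF, hS⟩ := exists_field_subfield_of_isPrimePow hq (show 0 < m by omega)
  obtain ⟨g, hg0, hgS, hg⟩ := exists_generator_mem_subfield_iff S (θ := θ) (by rw [hS, hF, hθ])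
  rw [hF, ← hθ, hde] at hg
  obtain ⟨lab, hlab, hmul, hinj⟩ := S.exists_label
  rw [hS] at hlab
  have hw1 : 1 < w := by
    have := Nat.minFac_le hw0
    omega
  exact isStrictlyOptimalFHSSet_of_modEq
    (card_hopping_alphabet (S := S) (by omega) (by omega) hF hS he hw0)
    (Nat.mul_pos (by omega) hw0) rfl he (lt_of_lt_of_le hw1 (Nat.le_mul_of_pos_right w hθ1))
    (pengFanBound_eq hm hw0 he hd hde.symm hθ)
    (fun a x => hoppingSeq S g lab d e w θ a x)
    (fun a x => hoppingSeq_mod hθ1 hg a x)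
    (fun a b τ x x' hab hx hx' => modEq_of_hoppingSeq_eq hg0 hθ1 hgS hg hθd hwe hwq hdq hlab
      hmul hinj a.2 b.2 (hab.imp_left fun h h' => h (Fin.ext h')) hx hx')
end

section
/- Let v be a positive integer with prime factorization v = p₁^{m₁}p₂^{m₂}⋯p_s^{m_s}, where p₁ < p₂ < ⋯ < p_s are primes. Let e > 1 be a common divisor of p₁−1, p₂−1, …, p_s−1 and let f = min{(p_i−1)/e : 1 ≤ i ≤ s}. Let w be an odd integer whose least prime factor is greater than p₁−1. If either v is not a prime and f > 1, or v is a prime and f ≥ e, then there exists a strictly optimal (ewv, f, e; (v−1+e)w)-FHS set; that is, there exists a set S of M = f FHSs of length n = ewv over an alphabet of size l = (v−1+e)w such that H(S;L) ≤ ⌈Le/n⌉ for every L with 1 ≤ L ≤ n, where e = ⌈(2InM−(I+1)Il)/((nM−1)M)⌉ with I = ⌊nM/l⌋. -/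
lemma pengFanBound_eq_of_bounds {n M l I e : ℕ} (hM : 0 < M) (hn : 1 < n * M)
    (hI : I * l ≤ n * M) (hI' : n * M < (I + 1) * l)
    (hlow : ((e : ℤ) - 1) * ((n * M - 1) * M) < 2 * I * n * M - (I + 1) * I * l)
    (hup : 2 * I * n * M - (I + 1) * I * l ≤ (e : ℤ) * ((n * M - 1) * M)) :
    pengFanBound n M l = e := by
  have hdiv : n * M / l = I := Nat.div_eq_of_lt_le hI hI'
  have hpos : (0 : ℚ) < (((n * M : ℕ) : ℚ) - 1) * (M : ℚ) := by
    have h1 : (1 : ℚ) < ((n * M : ℕ) : ℚ) := by exact_mod_cast hn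
    have h2 : (0 : ℚ) < M := by exact_mod_cast hM
    exact mul_pos (by linarith) h2
  unfold pengFanBound
  rw [hdiv, Int.ceil_eq_iff, lt_div_iff₀ hpos, div_le_iff₀ hpos]
  push_cast
  exact ⟨by exact_mod_cast hlow, by exact_mod_cast hup⟩

lemma pengFanBound_prime {e f w : ℕ} (he : 1 < e) (hfe : e ≤ f) (hw : 0 < w) :
    pengFanBound (e * w * (e * f + 1)) f ((e * f + e) * w) = e := by
  obtain ⟨g, rfl⟩ := Nat.exists_eq_add_of_le' (show 2 ≤ e from he)
  obtain ⟨h, rfl⟩ := Nat.exists_eq_add_of_le hfe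
  obtain ⟨y, rfl⟩ := Nat.exists_eq_add_of_le' (show 1 ≤ w from hw)
  apply pengFanBound_eq_of_bounds (I := (g + 2) * (g + 1 + h) + 1)
  · omega
  · ring_nf; omega
  · rw [← Nat.cast_le (α := ℤ), ← sub_nonneg]; push_cast; ring_nf; positivity
  · rw [← Nat.cast_lt (α := ℤ), ← sub_pos]; push_cast; ring_nf; positivity
  · rw [← sub_pos]; push_cast; ring_nf; positivity
  · rw [← sub_nonneg]; push_cast; ring_nf; positivity

lemma pengFanBound_of_sq_le {e f w v : ℕ} (he : 1 < e) (hf : 1 < f) (hw : 0 < w)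
    (hv : (e * f + 1) ^ 2 ≤ v) :
    pengFanBound (e * w * v) f ((v - 1 + e) * w) = e := by
  obtain ⟨g, rfl⟩ := Nat.exists_eq_add_of_le' (show 2 ≤ e from he)
  obtain ⟨h, rfl⟩ := Nat.exists_eq_add_of_le' (show 2 ≤ f from hf)
  obtain ⟨y, rfl⟩ := Nat.exists_eq_add_of_le' (show 1 ≤ w from hw)
  obtain ⟨z, rfl⟩ := Nat.exists_eq_add_of_le' hv
  have hsub : z + ((g + 2) * (h + 2) + 1) ^ 2 - 1 + (g + 2)
      = z + ((g + 2) * (h + 2)) ^ 2 + 2 * ((g + 2) * (h + 2)) + (g + 2) := by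
    rw [add_sq]; omega
  rw [hsub]
  apply pengFanBound_eq_of_bounds (I := g * h + 2 * g + 2 * h + 3)
  · omega
  · ring_nf; omega
  · rw [← Nat.cast_le (α := ℤ), ← sub_nonneg]; push_cast; ring_nf; positivity
  · rw [← Nat.cast_lt (α := ℤ), ← sub_pos]; push_cast; ring_nf; positivity
  · rw [← sub_pos]; push_cast; ring_nf; positivity
  · rw [← sub_nonneg]; push_cast; ring_nf; positivity

/-- Units `ε` with `ε ^ e = 1` and `u a` for `a < f` such that the differences of distinct
elements `ε ^ i * u a` are units. -/
def HasUnitDifferences (R : Type*) [CommRing R] (e f : ℕ) : Prop :=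
  ∃ (ε : Rˣ) (u : ℕ → Rˣ), ε ^ e = 1 ∧
    ∀ a < f, ∀ b < f, ∀ k : ℤ, (a ≠ b ∨ ¬ (e : ℤ) ∣ k) →
      IsUnit (((ε ^ k * u b : Rˣ) : R) - u a)

lemma HasUnitDifferences.map {R S : Type*} [CommRing R] [CommRing S] {e f : ℕ}
    (h : HasUnitDifferences R e f) (φ : R →+* S) : HasUnitDifferences S e f := by
  obtain ⟨ε, u, hε, hu⟩ := h
  refine ⟨Units.map φ ε, fun a => Units.map φ (u a), by rw [← map_pow, hε, map_one], ?_⟩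
  intro a ha b hb k hk
  have := (hu a ha b hb k hk).map φ
  rw [map_sub] at this
  rw [← map_zpow, ← map_mul]
  exact this

lemma HasUnitDifferences.pi {ι : Type*} {R : ι → Type*} [∀ i, CommRing (R i)] {e f : ℕ}
    (h : ∀ i, HasUnitDifferences (R i) e f) : HasUnitDifferences (∀ i, R i) e f := by
  choose ε u hε hu using h
  refine ⟨MulEquiv.piUnits.symm ε, fun a => MulEquiv.piUnits.symm fun i => u i a, ?_, ?_⟩
  · rw [← map_pow, (funext hε : ε ^ e = 1), map_one]
  · intro a ha b hb k hk
    rw [Pi.isUnit_iff]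
    intro i
    rw [← map_zpow, ← map_mul]
    exact hu i a ha b hb k hk

lemma ZMod.isUnit_of_castHom_ne_zero {p m : ℕ} (hp : p.Prime) (hm : 0 < m) {x : ZMod (p ^ m)}
    (hx : ZMod.castHom (dvd_pow_self p hm.ne') (ZMod p) x ≠ 0) : IsUnit x := by
  have : NeZero (p ^ m) := ⟨(pow_pos hp.pos m).ne'⟩
  obtain ⟨c, rfl⟩ := ZMod.natCast_zmod_surjective x
  rw [map_natCast, Ne, ZMod.natCast_eq_zero_iff] at hx
  rw [ZMod.isUnit_iff_coprime]
  exact (((Nat.Prime.coprime_iff_not_dvd hp).2 hx).pow_left m).symm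

lemma hasUnitDifferences_zmod_prime_pow {p m e f : ℕ} (hp : p.Prime) (hm : 0 < m) (he : 0 < e)
    (hep : e ∣ p - 1) (hf : f ≤ (p - 1) / e) : HasUnitDifferences (ZMod (p ^ m)) e f := by
  have : Fact p.Prime := ⟨hp⟩
  obtain ⟨d, hd⟩ := hep
  rw [hd, Nat.mul_div_cancel_left _ he] at hf
  obtain ⟨g, hg⟩ := IsCyclic.exists_generator (α := (ZMod p)ˣ)
  have hgord : orderOf g = p - 1 := by
    rw [orderOf_eq_card_of_forall_mem_zpowers hg, Nat.card_eq_fintype_card,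
      ZMod.card_units_eq_totient, Nat.totient_prime hp]
  have hpm : p ∣ p ^ m := dvd_pow_self p hm.ne'
  obtain ⟨t₀, ht₀⟩ := ZMod.unitsMap_surjective hpm g
  -- the Teichmüller lift of the primitive root `g`
  obtain ⟨t, ht1, htg⟩ : ∃ t : (ZMod (p ^ m))ˣ, t ^ (p - 1) = 1 ∧ ZMod.unitsMap hpm t = g := by
    refine ⟨t₀ ^ p ^ (m - 1), ?_, ?_⟩
    · rw [← pow_mul, ← Nat.totient_prime_pow hp hm, ZMod.pow_totient]
    · rw [map_pow, ht₀]
      ext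
      rw [Units.val_pow_eq_pow_val, ZMod.pow_card_pow]
  refine ⟨t ^ d, fun a => t ^ a, by rw [← pow_mul, mul_comm, ← hd, ht1], ?_⟩
  intro a ha b hb k hk
  apply ZMod.isUnit_of_castHom_ne_zero hp hm
  rw [map_sub, sub_ne_zero]
  intro heq
  have heq' : ZMod.unitsMap hpm ((t ^ d) ^ k * t ^ b) = ZMod.unitsMap hpm (t ^ a) :=
    Units.ext heq
  rw [map_mul, map_zpow, map_pow, map_pow, map_pow, htg, ← zpow_natCast, ← zpow_natCast,
    ← zpow_natCast, ← zpow_mul, ← zpow_add, zpow_eq_zpow_iff_modEq, hgord, hd,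
    Int.modEq_iff_dvd] at heq'
  push_cast at heq'
  have hab : a = b := by
    have hdvd : (d : ℤ) ∣ a - b := by
      have := ((Dvd.intro_left (e : ℤ) rfl).trans heq').add (Dvd.intro k rfl : (d : ℤ) ∣ d * k)
      rwa [sub_add_eq_sub_sub, sub_right_comm, sub_add_cancel] at this
    have := Int.eq_zero_of_abs_lt_dvd hdvd (by rw [abs_lt]; omega)
    omega
  have hd0 : (d : ℤ) ≠ 0 := by omega
  subst hab
  rw [sub_add_cancel_right, dvd_neg, mul_comm, mul_dvd_mul_iff_left hd0] at heq'
  exact hk.elim (fun h => h rfl) (fun h => h heq')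

lemma hasUnitDifferences_zmod_prod {s e f : ℕ} {p m : Fin s → ℕ} (hp : ∀ i, (p i).Prime)
    (hm : ∀ i, 0 < m i) (hinj : Function.Injective p) (he : 0 < e) (hep : ∀ i, e ∣ p i - 1)
    (hf : ∀ i, f ≤ (p i - 1) / e) : HasUnitDifferences (ZMod (∏ i, p i ^ m i)) e f := by
  have hcop : Pairwise (Function.onFun Nat.Coprime fun i => p i ^ m i) := fun i j hij =>
    Nat.Coprime.pow _ _ ((Nat.coprime_primes (hp i) (hp j)).2 (hinj.ne hij))
  exact (HasUnitDifferences.pi fun i =>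
    hasUnitDifferences_zmod_prime_pow (hp i) (hm i) he (hep i) (hf i)).map
      (ZMod.prodEquivPi _ hcop).symm.toRingHom

/-- Label each element by its exponent relative to a representative of its orbit under `ε`. -/
lemma exists_orbit_label {R : Type*} [CommRing R] {e : ℕ} (he : 0 < e) {ε : Rˣ}
    (hε : ε ^ e = 1) (hu : ∀ k : ℤ, ¬ (e : ℤ) ∣ k → IsUnit (((ε ^ k : Rˣ) : R) - 1)) :
    ∃ idx : R → ℕ, (∀ x, idx x < e) ∧
      ∀ x ≠ 0, ∀ k : ℤ, ¬ (e : ℤ) ∣ k → idx (((ε ^ k : Rˣ) : R) * x) ≠ idx x := by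
  let r : R → R := fun x =>
    (Quotient.mk (MulAction.orbitRel (Subgroup.zpowers ε) R) x).out
  have hr : ∀ x, ∃ k : ℤ, x = ((ε ^ k : Rˣ) : R) * r x := by
    intro x
    have h : (MulAction.orbitRel (Subgroup.zpowers ε) R).r x (r x) :=
      Setoid.symm' _ (Quotient.mk_out (s := MulAction.orbitRel (Subgroup.zpowers ε) R) x)
    obtain ⟨⟨_, k, rfl⟩, hk⟩ := h
    exact ⟨k, hk.symm⟩
  have hinv : ∀ (k : ℤ) x, r (((ε ^ k : Rˣ) : R) * x) = r x := by
    intro k x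
    have : Quotient.mk (MulAction.orbitRel (Subgroup.zpowers ε) R) (((ε ^ k : Rˣ) : R) * x)
        = Quotient.mk (MulAction.orbitRel (Subgroup.zpowers ε) R) x :=
      Quotient.sound ⟨⟨ε ^ k, k, rfl⟩, rfl⟩
    exact congrArg Quotient.out this
  choose K hK using hr
  have hmod : ∀ k : ℤ, ε ^ k = ε ^ (k % e) := fun k =>  by
    conv_lhs => rw [← Int.emod_add_mul_ediv k e, zpow_add, zpow_mul, zpow_natCast, hε, one_zpow,
      mul_one]
  have he' : (0 : ℤ) < e := by exact_mod_cast he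
  refine ⟨fun x => (K x % e).toNat, fun x => ?_, fun x hx k hk heq => hx ?_⟩
  · show (K x % e).toNat < e
    have := Int.emod_lt_of_pos (K x) he'
    have := Int.emod_nonneg (K x) he'.ne'
    omega
  · have h1 := Int.emod_nonneg (K x) he'.ne'
    have h2 := Int.emod_nonneg (K (((ε ^ k : Rˣ) : R) * x)) he'.ne'
    have h3 : K (((ε ^ k : Rˣ) : R) * x) % e = K x % e := by simp only at heq; omega
    have h4 : ((ε ^ k : Rˣ) : R) * x = x := by
      have h5 := hK (((ε ^ k : Rˣ) : R) * x)
      rw [hinv, hmod (K _), h3, ← hmod, ← hK] at h5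
      exact h5
    rw [← (hu k hk).mul_right_eq_zero, sub_mul, one_mul, h4, sub_self]

lemma ZMod.isUnit_natCast_of_lt_minFac {w c : ℕ} (hc : 0 < c) (hcw : c < w.minFac) :
    IsUnit (c : ZMod w) := by
  rw [ZMod.isUnit_iff_coprime]
  by_contra h
  obtain ⟨q, hq, hqc, hqw⟩ := Nat.Prime.not_coprime_iff_dvd.1 h
  exact absurd (Nat.minFac_le_of_dvd hq.two_le hqw) (by have := Nat.le_of_dvd hc hqc; omega)

lemma ZMod.isUnit_natCast_sub_natCast_of_lt_minFac {w c d : ℕ} (hcd : c ≠ d)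
    (hc : c < w.minFac) (hd : d < w.minFac) : IsUnit ((c : ZMod w) - d) := by
  rcases lt_or_gt_of_ne hcd with h | h
  · rw [← neg_sub, ← Nat.cast_sub h.le]
    exact (ZMod.isUnit_natCast_of_lt_minFac (by omega) (by omega)).neg
  · rw [← Nat.cast_sub h.le]
    exact ZMod.isUnit_natCast_of_lt_minFac (by omega) (by omega)

lemma partialHC_le_of_modEq {N d : ℕ} (hd : 0 < d) {F : Type*} [DecidableEq F]
    {X Y : ZMod N → F} {τ : ZMod N} (h : ∀ i k : ℤ, X i = Y ((i : ZMod N) + τ) →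
      X k = Y ((k : ZMod N) + τ) → i ≡ k [ZMOD d]) (j : ZMod N) (L : ℕ) :
    partialHC X Y τ j L ≤ (L + d - 1) / d := by
  obtain ⟨j, rfl⟩ := ZMod.intCast_surjective j
  rw [partialHC, ← Finset.card_filter, ← Finset.card_range ((L + d - 1) / d)]
  apply Finset.card_le_card_of_injOn (fun t => t / d)
  · intro t ht
    simp only [Finset.coe_filter, Finset.mem_range, Set.mem_ofPred_eq, Finset.coe_range,
      Set.mem_Iio] at ht ⊢
    rw [Nat.lt_iff_add_one_le, Nat.le_div_iff_mul_le hd, add_mul, one_mul]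
    have := Nat.div_mul_le_self t d
    omega
  · intro t ht t' ht' heq
    simp only [Finset.coe_filter, Finset.mem_range, Set.mem_ofPred_eq] at ht ht'
    have hmod := (h (j + t) (j + t') (by push_cast; exact ht.2)
      (by push_cast; exact ht'.2)).add_left_cancel' j
    rw [Int.natCast_modEq_iff] at hmod
    rw [← Nat.div_add_mod t d, ← Nat.div_add_mod t' d, show t / d = t' / d from heq,
      show t % d = t' % d from hmod]

lemma natCast_add_sub_one_div_le_ceil {e d L : ℕ} (he : 0 < e) (hd : 0 < d) :
    (((L + d - 1) / d : ℕ) : ℤ) ≤ ⌈((L * e : ℕ) : ℚ) / ((e * d : ℕ) : ℚ)⌉ := by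
  have he' : (e : ℚ) ≠ 0 := by exact_mod_cast he.ne'
  have hd' : (0 : ℚ) < d := by exact_mod_cast hd
  rw [Int.le_ceil_iff, Int.cast_natCast, Nat.cast_mul, Nat.cast_mul, mul_comm (L : ℚ), mul_div_mul_left _ _ he', lt_div_iff₀ hd']
  have h : (L + d - 1) / d * d < L + d := by
    have := Nat.div_mul_le_self (L + d - 1) d
    omega
  have h' : (((L + d - 1) / d : ℕ) : ℚ) * d < L + d := by
    rw [← Nat.cast_mul, ← Nat.cast_add, Nat.cast_lt]
    exact h
  linarith

/-- The component of the hopping symbols on which all hits of a pair of sequences lie in one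
residue class modulo `v`. -/
lemma exists_base_symbols {v e : ℕ} {ε : (ZMod v)ˣ} (u : ℕ → (ZMod v)ˣ) (hε : ε ^ e = 1) :
    ∃ B : ℕ → ℤ → {x : ZMod v // x ≠ 0} ⊕ ZMod e,
      (∀ a j s, B a (j + e * v * s) = B a j) ∧
      ∀ a b j τ, B a j = B b (j + τ) →
        (j : ZMod v) * (((ε ^ τ * u b : (ZMod v)ˣ) : ZMod v) - u a) = τ * u a ∧
        ((j : ZMod v) = 0 → (e : ℤ) ∣ τ) := by
  classical
  refine ⟨fun a j => if h : (j : ZMod v) = 0 then Sum.inr (j : ZMod e) else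
    Sum.inl ⟨(((ε ^ j * u a)⁻¹ : (ZMod v)ˣ) : ZMod v) * j, by
      rwa [Ne, Units.mul_right_eq_zero]⟩, fun a j s => ?_, fun a b j τ h => ?_⟩
  · have hpow : ε ^ (j + e * v * s) = ε ^ j := by
      rw [zpow_add, mul_assoc, zpow_mul, zpow_natCast, hε, one_zpow, mul_one]
    simp [hpow]
  · by_cases h₁ : (j : ZMod v) = 0 <;> by_cases h₂ : ((j + τ : ℤ) : ZMod v) = 0
    · simp only [h₁, h₂, dite_true, Sum.inr.injEq] at h
      rw [Int.cast_add, h₁, zero_add] at h₂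
      refine ⟨by rw [h₁, h₂, zero_mul, zero_mul], fun _ => ?_⟩
      rwa [Int.cast_add, left_eq_add, ZMod.intCast_zmod_eq_zero_iff_dvd] at h
    · simp only [h₁, h₂, dite_true, dite_false, reduceCtorEq] at h
    · simp only [h₁, h₂, dite_true, dite_false, reduceCtorEq] at h
    · simp only [h₁, h₂, dite_false, Sum.inl.injEq, Subtype.mk.injEq] at h
      refine ⟨?_, fun h₀ => absurd h₀ h₁⟩
      rw [Units.inv_mul_eq_iff_eq_mul, mul_left_comm, Units.eq_inv_mul_iff_mul_eq, zpow_add] at h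
      have hj : (((ε ^ j : (ZMod v)ˣ)) : ZMod v) *
          ((j : ZMod v) * (((ε ^ τ * u b : (ZMod v)ˣ) : ZMod v) - u a) - τ * u a) = 0 := by
        push_cast at h ⊢
        linear_combination h
      rwa [Units.mul_right_eq_zero, sub_eq_zero] at hj

lemma Int.cast_ediv_add_mul {v : ℕ} (hv : 0 < v) (R : Type*) [Ring R] (j s : ℤ) :
    (((j + v * s) / (v : ℤ) : ℤ) : R) = ((j / (v : ℤ) : ℤ) : R) + s := by
  rw [Int.add_mul_ediv_left _ _ (by omega), Int.cast_add]

lemma exists_sequences_hits_modEq {v w e f : ℕ} (hv : 0 < v) (hw : 0 < w) (he : 0 < e)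
    (hunits : HasUnitDifferences (ZMod v) e f) (hmin : e * f < w.minFac)
    (hcop : Nat.Coprime e (w * v)) :
    ∃ X : Fin f → ZMod (e * w * v) → Fin ((v - 1 + e) * w),
      ∀ (a b : Fin f) (τ : ZMod (e * w * v)), (a ≠ b ∨ τ ≠ 0) → ∀ i k : ℤ,
        X a i = X b ((i : ZMod (e * w * v)) + τ) → X a k = X b ((k : ZMod (e * w * v)) + τ) →
        i ≡ k [ZMOD (w * v : ℕ)] := by
  classical
  have : NeZero v := ⟨hv.ne'⟩
  have : NeZero w := ⟨hw.ne'⟩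
  have : NeZero e := ⟨he.ne'⟩
  have : NeZero (e * w * v) := ⟨by positivity⟩
  obtain ⟨ε, u, hε, hu⟩ := hunits
  obtain ⟨B, hBper, hB⟩ := exists_base_symbols u hε
  rcases Nat.eq_zero_or_pos f with rfl | hf
  · exact ⟨fun a => a.elim0, fun a => a.elim0⟩
  obtain ⟨idx, hidx, hidx'⟩ := exists_orbit_label he hε fun k hk => by
    have h := (hu 0 hf 0 hf k (Or.inr hk)).mul (u 0)⁻¹.isUnit
    rwa [sub_mul, ← Units.val_mul, mul_inv_cancel_right, Units.mul_inv] at h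
  -- multipliers of the lifting, pairwise different on every block
  let μ : ℕ → ZMod v → ℕ := fun a x => a * e + idx x + 1
  have hμlt : ∀ a < f, ∀ x, μ a x < w.minFac := fun a ha x => by
    have h1 := hidx x
    have h2 : e * (a + 1) ≤ e * f := Nat.mul_le_mul_left e ha
    have h3 : e * (a + 1) = a * e + e := by ring
    simp only [μ]; omega
  have hμne : ∀ a b x y, μ a x = μ b y → a = b ∧ idx x = idx y := fun a b x y h => by
    have h1 : e * a + idx x = e * b + idx y := by simp only [μ] at h; linarith
    have h2 := congrArg (· / e) h1
    simp only [Nat.mul_add_div he, Nat.div_eq_of_lt (hidx _), add_zero] at h2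
    subst h2
    exact ⟨rfl, by omega⟩
  let Y : ℕ → ℤ → ({x : ZMod v // x ≠ 0} ⊕ ZMod e) × ZMod w := fun a j =>
    (B a j, ((j / (v : ℤ) : ℤ) : ZMod w) * (μ a j : ZMod w))
  have hYper : ∀ a j s, Y a (j + (e * w * v : ℕ) * s) = Y a j := fun a j s => by
    have h1 : j + (e * w * v : ℕ) * s = j + e * v * (w * s) := by push_cast; ring
    have h2 : j + e * v * (w * s) = j + v * (e * w * s) := by ring
    simp only [Y, h1, hBper]
    rw [h2, Int.cast_ediv_add_mul hv]
    simp
  have hYcast : ∀ (a : ℕ) (j : ℤ), Y a ((j : ZMod (e * w * v)).val : ℤ) = Y a j := fun a j => by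
    rw [ZMod.val_intCast]
    conv_rhs => rw [← Int.emod_add_mul_ediv j (e * w * v : ℕ), hYper]
  have hYhits : ∀ (a b : Fin f) (τ : ℤ), (a ≠ b ∨ (τ : ZMod (e * w * v)) ≠ 0) → ∀ i k : ℤ,
      Y a i = Y b (i + τ) → Y a k = Y b (k + τ) → i ≡ k [ZMOD (w * v : ℕ)] := by
    intro a b τ hne i k hi hk
    simp only [Y, Prod.mk.injEq] at hi hk
    obtain ⟨hi1, hi0⟩ := hB _ _ _ _ hi.1
    obtain ⟨hk1, -⟩ := hB _ _ _ _ hk.1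
    by_cases hcase : a ≠ b ∨ ¬ (e : ℤ) ∣ τ
    · have hunit := hu a a.2 b b.2 τ (hcase.imp_left Fin.val_ne_of_ne)
      have hik : (i : ZMod v) = k := hunit.mul_right_cancel (hi1.trans hk1.symm)
      obtain ⟨s, hs⟩ := (ZMod.intCast_eq_intCast_iff_dvd_sub i k v).1 hik
      obtain rfl : k = i + v * s := by linarith
      have hμ : μ a i ≠ μ b (i + τ : ℤ) := by
        intro h
        obtain ⟨hab, hid⟩ := hμne _ _ _ _ h
        have hτ := hcase.resolve_left (fun h => h (Fin.ext hab))
        have hx : (i : ZMod v) ≠ 0 := fun h => hτ (hi0 h)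
        refine hidx' i hx τ hτ (Eq.trans (congrArg idx ?_) hid.symm)
        rw [← hab] at hi1
        apply (u a).isUnit.mul_right_cancel
        push_cast at hi1 ⊢
        linear_combination hi1
      have hsub := ZMod.isUnit_natCast_sub_natCast_of_lt_minFac hμ (hμlt a a.2 _) (hμlt b b.2 _)
      have hk2 := hk.2
      rw [add_right_comm, Int.cast_ediv_add_mul hv, Int.cast_ediv_add_mul hv] at hk2
      simp only [Int.cast_add, Int.cast_mul, Int.cast_natCast, CharP.cast_eq_zero, zero_mul,
        add_zero] at hk2 hi hsub
      have hs0 : (s : ZMod w) = 0 := by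
        rw [← hsub.mul_left_eq_zero]
        linear_combination hk2 - hi.2
      obtain ⟨r, rfl⟩ := (ZMod.intCast_zmod_eq_zero_iff_dvd s w).1 hs0
      rw [Int.modEq_iff_dvd]
      exact ⟨r, by push_cast; ring⟩
    · push Not at hcase
      obtain ⟨rfl, hτ⟩ := hcase
      exfalso
      refine hne.elim (fun h => h rfl) fun h => h ?_
      obtain ⟨r, hr⟩ := id hτ
      have hετ : ε ^ τ = 1 := by rw [hr, zpow_mul, zpow_natCast, hε, one_zpow]
      rw [hετ, one_mul, sub_self, mul_zero, eq_comm, Units.mul_left_eq_zero] at hi1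
      obtain ⟨s, rfl⟩ := (ZMod.intCast_zmod_eq_zero_iff_dvd τ v).1 hi1
      have hi2 := hi.2
      rw [Int.cast_ediv_add_mul hv] at hi2
      simp only [Int.cast_add, Int.cast_mul, Int.cast_natCast, CharP.cast_eq_zero, zero_mul,
        add_zero] at hi2
      have hs0 : (s : ZMod w) = 0 := by
        rw [← (ZMod.isUnit_natCast_of_lt_minFac (Nat.succ_pos _)
          (hμlt a a.2 (i : ZMod v))).mul_left_eq_zero]
        linear_combination -hi2
      obtain ⟨q, rfl⟩ := (ZMod.intCast_zmod_eq_zero_iff_dvd s w).1 hs0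
      rw [ZMod.intCast_zmod_eq_zero_iff_dvd, mul_assoc, Nat.cast_mul]
      exact (Nat.isCoprime_iff_coprime.2 hcop).mul_dvd hτ ⟨q, by push_cast; ring⟩
  have hcard : Fintype.card (({x : ZMod v // x ≠ 0} ⊕ ZMod e) × ZMod w) = (v - 1 + e) * w := by
    rw [Fintype.card_prod, Fintype.card_sum, ZMod.card, ZMod.card, Fintype.card_subtype_compl,
      ZMod.card, Fintype.card_subtype_eq]
  let φ := Fintype.equivFinOfCardEq hcard
  refine ⟨fun a t => φ (Y a t.val), fun a b τ hne i k hi hk => ?_⟩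
  obtain ⟨τ, rfl⟩ := ZMod.intCast_surjective τ
  rw [← Int.cast_add] at hi hk
  simp only [EmbeddingLike.apply_eq_iff_eq, hYcast] at hi hk
  exact hYhits a b τ hne i k hi hk

lemma isStrictlyOptimalFHSSet_of_hasUnitDifferences {v w e f : ℕ} (hv : 1 < v) (hw : 0 < w)
    (he : 0 < e) (hunits : HasUnitDifferences (ZMod v) e f) (hmin : e * f < w.minFac)
    (hcop : Nat.Coprime e (w * v))
    (hbound : pengFanBound (e * w * v) f ((v - 1 + e) * w) = e) :
    IsStrictlyOptimalFHSSet (e * w * v) f e ((v - 1 + e) * w) := by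
  obtain ⟨X, hX⟩ := exists_sequences_hits_modEq (by omega) hw he hunits hmin hcop
  have hwv : 0 < w * v := by positivity
  have hceil : ∀ L : ℕ, (((L + w * v - 1) / (w * v) : ℕ) : ℤ)
      ≤ ⌈((L * e : ℕ) : ℚ) / ((e * w * v : ℕ) : ℚ)⌉ := fun L => by
    rw [mul_assoc e w v]
    exact natCast_add_sub_one_div_le_ceil he hwv
  refine ⟨hbound.symm, X, fun a b hab hXab => ?_, fun L _ _ =>
    ⟨fun a τ hτ j => ?_, fun a b hab τ j => ?_⟩⟩
  · have h := hX a b 0 (Or.inl hab) 0 1 (by rw [hXab, add_zero]) (by rw [hXab, add_zero])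
    rw [Int.modEq_iff_dvd, sub_zero] at h
    have h1 : w * v ∣ 1 := by exact_mod_cast h
    have h2 := Nat.le_of_dvd one_pos h1
    have h3 := Nat.le_mul_of_pos_left v hw
    omega
  · exact (Int.ofNat_le.2 (partialHC_le_of_modEq hwv (hX a a τ (Or.inr hτ)) j L)).trans
      (hceil L)
  · exact (Int.ofNat_le.2 (partialHC_le_of_modEq hwv (hX a b τ (Or.inl hab)) j L)).trans
      (hceil L)

theorem stmt10 (s : ℕ) (hs : 0 < s) (p : Fin s → ℕ) (mExp : Fin s → ℕ)
    (hp : ∀ i, (p i).Prime) (hmExp : ∀ i, 0 < mExp i) (hmono : StrictMono p)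
    (v : ℕ) (hv : v = ∏ i : Fin s, p i ^ mExp i)
    (e : ℕ) (he : 1 < e) (hed : ∀ i, e ∣ p i - 1)
    (f : ℕ)
    (hf : f = Finset.univ.inf' ⟨⟨0, hs⟩, Finset.mem_univ _⟩ (fun i => (p i - 1) / e))
    (w : ℕ) (hw : Odd w) (hwp : p ⟨0, hs⟩ - 1 < w.minFac)
    (hcond : (¬ v.Prime ∧ 1 < f) ∨ (v.Prime ∧ e ≤ f)) :
    IsStrictlyOptimalFHSSet (e * w * v) f e ((v - 1 + e) * w) := by
  have hp0 := hp ⟨0, hs⟩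
  have hfle : ∀ i, f ≤ (p i - 1) / e := fun i => hf ▸ Finset.inf'_le _ (Finset.mem_univ i)
  have hef : ∀ i, e * f ≤ p i - 1 := fun i =>
    (Nat.mul_le_mul_left e (hfle i)).trans (Nat.mul_div_le _ _)
  have hw0 : 0 < w := hw.pos
  have hf1 : 1 < f := hcond.elim (fun h => h.2) (fun h => by omega)
  have hpv : ∀ i, p i ∣ v := fun i => hv ▸
    (dvd_pow_self _ (hmExp i).ne').trans (Finset.dvd_prod_of_mem _ (Finset.mem_univ i))
  have hv0 : 0 < v := hv ▸ Finset.prod_pos fun i _ => pow_pos (hp i).pos _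
  have hv1 : 1 < v := hp0.one_lt.trans_le (Nat.le_of_dvd hv0 (hpv _))
  have hlt : e * f < w.minFac := (hef _).trans_lt hwp
  have hew : Nat.Coprime e w := (ZMod.isUnit_iff_coprime e w).1
    (ZMod.isUnit_natCast_of_lt_minFac (by omega) (by nlinarith))
  have hev : Nat.Coprime e v := by
    rw [hv]
    refine Nat.Coprime.prod_right fun i _ => Nat.Coprime.pow_right _ ?_
    refine Nat.Coprime.coprime_dvd_left (hed i) ?_
    exact (Nat.coprime_self_sub_left (hp i).one_le).2 (Nat.coprime_one_left _)
  have hunits : HasUnitDifferences (ZMod v) e f := by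
    rw [hv]
    exact hasUnitDifferences_zmod_prod hp hmExp hmono.injective (by omega) hed hfle
  refine isStrictlyOptimalFHSSet_of_hasUnitDifferences hv1 hw0 (by omega) hunits hlt
    (hew.mul_right hev) ?_
  rcases hcond with ⟨hnp, -⟩ | ⟨hvp, hle⟩
  · refine pengFanBound_of_sq_le he hf1 hw0 (le_trans ?_ (Nat.minFac_sq_le_self hv0 hnp))
    have hq := Nat.minFac_prime hv1.ne'
    obtain ⟨i, -, hi⟩ := (Prime.dvd_finsetProd_iff hq.prime _).1 ((Nat.minFac_dvd v).trans hv.dvd)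
    rw [(Nat.prime_dvd_prime_iff_eq hq (hp i)).1 (hq.dvd_of_dvd_pow hi)]
    have := hef i
    have := (hp i).pos
    exact Nat.pow_le_pow_left (by omega) 2
  · obtain ⟨i, -, hi⟩ := Finset.exists_mem_eq_inf' (s := Finset.univ)
      ⟨(⟨0, hs⟩ : Fin s), Finset.mem_univ _⟩ (fun i => (p i - 1) / e)
    have hvi : v - 1 = e * f := by
      rw [← (Nat.prime_dvd_prime_iff_eq (hp i) hvp).1 (hpv i), hf, hi,
        Nat.mul_div_cancel' (hed i)]
    rw [hvi, show v = e * f + 1 by omega]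
    exact pengFanBound_prime he hle hw0
end

section
/- Suppose s | g and {B₀,…,B_{M−1}} is an (mg, g, {K₀,…,K_{M−1}}, 1)-BNCRDP of size u over Z_{mg}, with B_j = {B₀^j,…,B_{u−1}^j}, such that for each j the set of all elements of the base blocks of B_j together with {0, m, 2m, …, (s−1)m} is a complete system of representatives for the cosets of smZ_{mg} in Z_{mg}. Let q be a prime power with q ≥ max_{0≤k<u} Σ_{j=0}^{M−1} |B_k^j| and gcd(q−1, g/s) = 1. Then there exist sets K₀′,…,K_{M−1}′ with K_j′ ⊆ K_j ∪ {k−1 : k ∈ K_j} and an (mg(q−1), g(q−1), {K₀′,…,K_{M−1}′}, 1)-BNCRDP of size uq over Z_{mg(q−1)}, say {B₀′,…,B_{M−1}′}, such that for each j the set of all elements of the base blocks of B_j′ together with {0, m, 2m, …, (s(q−1)−1)m} is a complete system of representatives for the cosets of sm(q−1)Z_{mg(q−1)} in Z_{mg(q−1)}. -/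
open scoped Classical

lemma sum_val_map_eq {ι α β : Type*} [Fintype ι] (S : ι → Finset α) (f : α → β) :
    ∑ i, (S i).val.map f = (Finset.univ.sigma S).val.map (fun z => f z.2) := by
  change _ = (Multiset.sigma Finset.univ.val fun i => (S i).val).map (fun z => f z.2)
  rw [Multiset.sigma, Multiset.map_bind]
  simp only [Multiset.map_map, Function.comp_def]
  rfl

lemma count_sum_val_map_eq_zero_iff {ι α β : Type*} [Fintype ι] [DecidableEq β]
    (S : ι → Finset α) (f : α → β) (x : β) :
    (∑ i, (S i).val.map f).count x = 0 ↔ ∀ i, ∀ a ∈ S i, f a ≠ x := by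
  simp [sum_val_map_eq]

lemma count_sum_val_map_le_one_iff {ι α β : Type*} [Fintype ι] [DecidableEq β]
    (S : ι → Finset α) (f : α → β) (x : β) :
    (∑ i, (S i).val.map f).count x ≤ 1 ↔
      ∀ i, ∀ a ∈ S i, ∀ i', ∀ a' ∈ S i', f a = x → f a' = x → i = i' ∧ a = a' := by
  rw [sum_val_map_eq, Multiset.count_map, ← Finset.filter_val, Finset.card_val,
    Finset.card_le_one]
  constructor
  · intro h i a ha i' a' ha' hx hx'
    have := h ⟨i, a⟩ (by simp [ha, hx]) ⟨i', a'⟩ (by simp [ha', hx'])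
    simpa using this
  · rintro h ⟨i, a⟩ ha ⟨i', a'⟩ ha'
    simp only [Finset.mem_filter, Finset.mem_sigma, Finset.mem_univ, true_and] at ha ha'
    obtain ⟨rfl, rfl⟩ := h i a ha.1 i' a' ha'.1 ha.2.symm ha'.2.symm
    rfl

lemma card_filter_blockElems {n u : ℕ} (B : Fin u → Finset (ZMod n)) (P : ZMod n → Prop) :
    ((blockElems B).filter P).card =
      ((Finset.univ.sigma B).filter (fun z => P z.2)).card := by
  have h := sum_val_map_eq B (fun a : ZMod n => a)
  simp only [Multiset.map_id'] at h
  rw [blockElems, h, Multiset.filter_map, Multiset.card_map, ← Finset.card_val,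
    Finset.filter_val]
  rfl

/-- Relative difference packings and their balanced nested families, in a uniform form: the
internal and the external differences are the differences of distinct labelled elements. -/
lemma isBNCRDP_iff {n g M u : ℕ} (K : Fin M → Set ℕ) (B : Fin M → Fin u → Finset (ZMod n)) :
    IsBNCRDP n g M u K B ↔ (∀ j i, (B j i).card ∈ K j) ∧ ∀ j j' : Fin M,
      (∀ i, ∀ a ∈ B j i, ∀ b ∈ B j' i, (j = j' → a ≠ b) → ¬ inSub n (n / g) (b - a)) ∧
      (∀ i, ∀ a ∈ B j i, ∀ b ∈ B j' i, (j = j' → a ≠ b) →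
        ∀ i', ∀ a' ∈ B j i', ∀ b' ∈ B j' i', (j = j' → a' ≠ b') →
          b - a = b' - a' → i = i' ∧ a = a' ∧ b = b') := by
  simp only [IsBNCRDP, IsCRDP, deltaList, deltaE, count_sum_val_map_eq_zero_iff,
    count_sum_val_map_le_one_iff, Finset.mem_filter, Finset.mem_product, Prod.forall,
    Prod.mk.injEq]
  constructor
  · rintro ⟨h₁, h₂⟩
    refine ⟨fun j => (h₁ j).1, fun j j' => ?_⟩
    obtain rfl | hj := eq_or_ne j j'
    · refine ⟨fun i a ha b hb hab hx => (h₁ j).2.1 _ hx i b a ⟨⟨hb, ha⟩, (hab rfl).symm⟩ rfl,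
        fun i a ha b hb hab i' a' ha' b' hb' hab' he => ?_⟩
      have := (h₁ j).2.2 _ i b a ⟨⟨hb, ha⟩, (hab rfl).symm⟩ i' b' a'
        ⟨⟨hb', ha'⟩, (hab' rfl).symm⟩ rfl he.symm
      tauto
    · exact ⟨fun i a ha b hb _ hx => (h₂ j j' hj).1 _ hx i a b ⟨ha, hb⟩ rfl,
        fun i a ha b hb _ i' a' ha' b' hb' _ he =>
          (h₂ j j' hj).2 _ i a b ⟨ha, hb⟩ i' a' b' ⟨ha', hb'⟩ rfl he.symm⟩
  · rintro ⟨h₁, h₂⟩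
    refine ⟨fun j => ⟨h₁ j, ?_, ?_⟩, fun j j' hj => ⟨?_, ?_⟩⟩
    · rintro x hx i a b ⟨⟨ha, hb⟩, hab⟩ rfl
      exact (h₂ j j).1 i b hb a ha (fun _ => hab.symm) hx
    · rintro x i a b ⟨⟨ha, hb⟩, hab⟩ i' a' b' ⟨⟨ha', hb'⟩, hab'⟩ rfl he
      have := (h₂ j j).2 i b hb a ha (fun _ => hab.symm) i' b' hb' a' ha'
        (fun _ => hab'.symm) he.symm
      tauto
    · rintro x hx i a b ⟨ha, hb⟩ rfl
      exact (h₂ j j').1 i a ha b hb (fun h => absurd h hj) hx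
    · rintro x i a b ⟨ha, hb⟩ i' a' b' ⟨ha', hb'⟩ rfl he
      exact (h₂ j j').2 i a ha b hb (fun h => absurd h hj) i' a' ha' b' hb'
        (fun h => absurd h hj) he.symm

lemma inSub_iff_castHom_eq_zero {N d : ℕ} (h : d ∣ N) (x : ZMod N) :
    inSub N d x ↔ ZMod.castHom h (ZMod d) x = 0 := by
  constructor
  · rintro ⟨y, rfl⟩
    rw [map_mul, map_natCast, ZMod.natCast_self, zero_mul]
  · intro hx
    obtain ⟨z, rfl⟩ := ZMod.intCast_surjective x
    rw [map_intCast, ZMod.intCast_zmod_eq_zero_iff_dvd] at hx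
    obtain ⟨w, rfl⟩ := hx
    exact ⟨w, by push_cast; ring⟩

lemma inSub_castHom_iff {N n d : ℕ} (hn : n ∣ N) (hd : d ∣ n) (x : ZMod N) :
    inSub n d (ZMod.castHom hn (ZMod n) x) ↔ inSub N d x := by
  rw [inSub_iff_castHom_eq_zero hd, inSub_iff_castHom_eq_zero (hd.trans hn)]
  rw [← RingHom.comp_apply, ZMod.castHom_comp]

/-- The number of multiples `k * m` with `k < s` in a given coset of `s * m` is `1` or `0`
according to whether the coset consists of multiples of `m`. -/
lemma card_filter_range_map {n s m : ℕ} (hs : 0 < s) (hm : 0 < m) (h : s * m ∣ n)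
    (x : ZMod n) :
    (((Multiset.range s).map (fun k => ((k * m : ℕ) : ZMod n))).filter
      (fun t => inSub n (s * m) (x - t))).card = if inSub n m x then 1 else 0 := by
  have hmn : m ∣ n := (dvd_mul_left m s).trans h
  obtain ⟨z, rfl⟩ := ZMod.intCast_surjective x
  have key (k : ℕ) : inSub n (s * m) ((z : ZMod n) - ((k * m : ℕ) : ZMod n)) ↔
      ((s * m : ℕ) : ℤ) ∣ z - k * m := by
    rw [inSub_iff_castHom_eq_zero h, ← ZMod.intCast_zmod_eq_zero_iff_dvd, map_sub, map_intCast,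
      map_natCast]
    push_cast
    rfl
  have key' : inSub n m (z : ZMod n) ↔ (m : ℤ) ∣ z := by
    rw [inSub_iff_castHom_eq_zero hmn, ← ZMod.intCast_zmod_eq_zero_iff_dvd]
    simp
  rw [Multiset.filter_map, Multiset.card_map, ← Finset.range_val, ← Finset.filter_val,
    Finset.card_val]
  simp only [Function.comp_def, key, key']
  split_ifs with hz
  · obtain ⟨y, rfl⟩ := hz
    have hs' : (0 : ℤ) < s := by exact_mod_cast hs
    have hm' : (m : ℤ) ≠ 0 := by exact_mod_cast hm.ne'
    rw [Finset.card_eq_one]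
    refine ⟨(y % s).toNat, ?_⟩
    have h0 := Int.emod_nonneg y hs'.ne'
    have h1 := Int.emod_lt_of_pos y hs'
    ext k
    have : ((s * m : ℕ) : ℤ) ∣ m * y - k * m ↔ (s : ℤ) ∣ y - k := by
      rw [show (m : ℤ) * y - k * m = (y - k) * m by ring, Nat.cast_mul]
      exact mul_dvd_mul_iff_right hm'
    rw [Finset.mem_filter, Finset.mem_range, Finset.mem_singleton, this]
    constructor
    · rintro ⟨hk, hd⟩
      have h2 := (Int.emod_eq_emod_iff_emod_sub_eq_zero).2 (Int.emod_eq_zero_of_dvd hd)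
      rw [Int.emod_eq_of_lt (by positivity : (0 : ℤ) ≤ k) (by exact_mod_cast hk)] at h2
      omega
    · rintro rfl
      refine ⟨by omega, ?_⟩
      rw [Int.toNat_of_nonneg h0]
      exact Int.dvd_self_sub_emod
  · rw [Finset.card_eq_zero, Finset.filter_eq_empty_iff]
    intro k _ hk
    apply hz
    have h1 : (m : ℤ) ∣ z - k * m := (by push_cast; exact dvd_mul_left _ _ : (m : ℤ) ∣ _).trans hk
    simpa using h1.add (dvd_mul_left (m : ℤ) k)

/-- A discrete logarithm of a finite field with `r + 1` elements, with values in the subgroup of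
order `r` of `ZMod (n * r)`. -/
lemma exists_log (F : Type*) [Field F] [Finite F] {n r : ℕ} [NeZero n] [NeZero r]
    (hF : Nat.card F = r + 1) :
    ∃ φ : Fˣ → ZMod (n * r), (∀ x y, φ (x * y) = φ x + φ y) ∧ Function.Injective φ ∧
      ∀ z, ZMod.castHom (dvd_mul_right n r) (ZMod n) z = 0 ↔ ∃ x, φ x = z := by
  set π := (ZMod.castHom (dvd_mul_right n r) (ZMod n)).toAddMonoidHom
  have hsurj : Function.Surjective π := ZMod.castHom_surjective (dvd_mul_right n r)
  have hcard : Nat.card π.ker = r := by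
    have h1 := AddSubgroup.card_eq_card_quotient_mul_card_addSubgroup π.ker
    rw [Nat.card_congr (QuotientAddGroup.quotientKerEquivOfSurjective π hsurj).toEquiv] at h1
    simp only [Nat.card_zmod] at h1
    exact (Nat.eq_of_mul_eq_mul_left (NeZero.pos n) h1).symm
  have hunits : Nat.card Fˣ = r := by
    rw [Nat.card_units, hF]; rfl
  let e : Fˣ ≃* Multiplicative π.ker := mulEquivOfCyclicCardEq (by
    rw [hunits]; exact hcard.symm)
  refine ⟨fun x => ((e x).toAdd : ZMod (n * r)), fun x y => by simp, ?_, fun z => ?_⟩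
  · intro x y h
    exact e.injective (Multiplicative.toAdd.injective (Subtype.ext h))
  · constructor
    · intro hz
      exact ⟨e.symm (Multiplicative.ofAdd ⟨z, hz⟩), by simp⟩
    · rintro ⟨x, rfl⟩
      exact (e x).toAdd.2

lemma exists_labelling {F : Type*} [Finite F] {n M : ℕ} (S : Fin M → Finset (ZMod n))
    [Nonempty F] (h : ∑ j, (S j).card ≤ Nat.card F) :
    ∃ α : Fin M → ZMod n → F, ∀ j, ∀ a ∈ S j, ∀ j', ∀ a' ∈ S j', α j a = α j' a' →
      j = j' ∧ a = a' := by
  have := Fintype.ofFinite F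
  have hc : Fintype.card (Finset.univ.sigma S) ≤ Fintype.card F := by
    rw [Fintype.card_coe, Finset.card_sigma, ← Nat.card_eq_fintype_card]
    exact h
  obtain ⟨f⟩ := Function.Embedding.nonempty_of_card_le hc
  let c : F := Classical.arbitrary F
  refine ⟨fun j a => if ha : a ∈ S j then f ⟨⟨j, a⟩, by simp [ha]⟩ else c, ?_⟩
  intro j a ha j' a' ha' he
  simp only [ha, ha', dif_pos] at he
  simpa using f.injective he

lemma exists_inSub_sub_of_coprime {d g r : ℕ} (h : r.Coprime g) {z : ZMod (d * g * r)}
    (hz : inSub (d * g * r) d z) :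
    ∃ y, inSub (d * g * r) (d * g) y ∧ inSub (d * g * r) (d * r) (z - y) := by
  obtain ⟨w, rfl⟩ := hz
  obtain ⟨a, b, hab⟩ := Nat.isCoprime_iff_coprime.2 h
  have hab' : (a : ZMod (d * g * r)) * r + b * g = 1 := by exact_mod_cast congrArg (Int.cast : ℤ → ZMod (d * g * r)) hab
  refine ⟨((d * g : ℕ) : ZMod (d * g * r)) * (b * w), ⟨_, rfl⟩, a * w, ?_⟩
  push_cast
  linear_combination (-d * w : ZMod (d * g * r)) * hab'

lemma eq_zero_of_inSub_of_coprime {d g r : ℕ} (h : r.Coprime g) {z : ZMod (d * g * r)}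
    (h₁ : inSub (d * g * r) (d * g) z) (h₂ : inSub (d * g * r) (d * r) z) : z = 0 := by
  obtain ⟨v, hv⟩ := h₁
  obtain ⟨w, hw⟩ := h₂
  obtain ⟨a, b, hab⟩ := Nat.isCoprime_iff_coprime.2 h
  have hab' : (a : ZMod (d * g * r)) * r + b * g = 1 := by exact_mod_cast congrArg (Int.cast : ℤ → ZMod (d * g * r)) hab
  have h0 : ((d : ZMod (d * g * r)) * g * r) = 0 := by
    exact_mod_cast ZMod.natCast_self (d * g * r)
  push_cast at hv hw
  linear_combination (-z) * hab' + a * r * hv + b * g * hw + (a * v + b * w) * h0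

section Construction

variable {n r : ℕ} {F : Type*} [Field F]

/-- The translate by `t` of a block `S` labelled by elements of a field `F`, spread over the
fibres of `ZMod (n * r) → ZMod n` by a discrete logarithm `φ`. -/
noncomputable def inflate (φ : Fˣ → ZMod (n * r)) (S : Finset (ZMod n)) (α : ZMod n → F) (t : F) :
    Finset (ZMod (n * r)) :=
  (S.filter (fun b => t + α b ≠ 0)).image
    (fun b => (b.cast : ZMod (n * r)) + if h : t + α b = 0 then 0 else φ (Units.mk0 _ h))

variable [NeZero n] {φ : Fˣ → ZMod (n * r)}

lemma castHom_cast_add (hφ : ∀ x, ZMod.castHom (dvd_mul_right n r) (ZMod n) (φ x) = 0)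
    (b : ZMod n) (x : Fˣ) :
    ZMod.castHom (dvd_mul_right n r) (ZMod n) ((b.cast : ZMod (n * r)) + φ x) = b := by
  rw [map_add, hφ, add_zero, ← ZMod.natCast_val, map_natCast, ZMod.natCast_val, ZMod.cast_id', id]

lemma mem_inflate (hφ : ∀ x, ZMod.castHom (dvd_mul_right n r) (ZMod n) (φ x) = 0)
    {S : Finset (ZMod n)} {α : ZMod n → F} {t : F} {c : ZMod (n * r)} :
    c ∈ inflate φ S α t ↔ ∃ b ∈ S, ZMod.castHom (dvd_mul_right n r) (ZMod n) c = b ∧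
      ∃ x : Fˣ, (x : F) = t + α b ∧ c = (b.cast : ZMod (n * r)) + φ x := by
  simp only [inflate, Finset.mem_image, Finset.mem_filter]
  constructor
  · rintro ⟨b, ⟨hb, h0⟩, rfl⟩
    rw [dif_neg h0]
    exact ⟨b, hb, castHom_cast_add hφ _ _, Units.mk0 _ h0, rfl, rfl⟩
  · rintro ⟨b, hb, -, x, hx, rfl⟩
    have h0 : t + α b ≠ 0 := hx ▸ x.ne_zero
    refine ⟨b, ⟨hb, h0⟩, ?_⟩
    rw [dif_neg h0]
    congr 2
    exact Units.ext hx.symm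

lemma card_inflate (hφ : ∀ x, ZMod.castHom (dvd_mul_right n r) (ZMod n) (φ x) = 0)
    {S : Finset (ZMod n)} {α : ZMod n → F} (hα : ∀ a ∈ S, ∀ b ∈ S, α a = α b → a = b) (t : F) :
    (inflate φ S α t).card = S.card ∨ (inflate φ S α t).card = S.card - 1 := by
  have hinj : (inflate φ S α t).card = (S.filter (fun b => t + α b ≠ 0)).card := by
    refine Finset.card_image_of_injOn fun a ha b hb hab => ?_
    have ha' := (Finset.mem_filter.1 ha).2
    have hb' := (Finset.mem_filter.1 hb).2
    simp only [dif_neg ha', dif_neg hb'] at hab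
    rw [← castHom_cast_add hφ a, hab, castHom_cast_add hφ]
  rw [hinj]
  by_cases h : ∃ a ∈ S, t + α a = 0
  · obtain ⟨a, ha, ha0⟩ := h
    right
    rw [← Finset.card_erase_of_mem ha]
    congr 1
    ext b
    rw [Finset.mem_filter, Finset.mem_erase, and_comm]
    refine and_congr_left fun hb => not_congr ⟨fun hb0 => ?_, ?_⟩
    · exact hα b hb a ha (add_left_cancel (hb0.trans ha0.symm))
    · rintro rfl; exact ha0
  · push Not at h
    left
    rw [Finset.filter_true_of_mem h]

end Construction

/-- Inflating by all translations creates no new coincidence between differences. -/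
lemma isBNCRDP_inflate {m g r u v M : ℕ} [NeZero (m * g)] [NeZero r] (hg : 0 < g) {F : Type*}
    [Field F] {K : Fin M → Set ℕ} {B : Fin M → Fin u → Finset (ZMod (m * g))}
    (hB : IsBNCRDP (m * g) g M u K B) {φ : Fˣ → ZMod (m * g * r)}
    (hmul : ∀ x y, φ (x * y) = φ x + φ y) (hinj : Function.Injective φ)
    (hφ : ∀ x, ZMod.castHom (dvd_mul_right (m * g) r) (ZMod (m * g)) (φ x) = 0)
    (α : Fin u → Fin M → ZMod (m * g) → F)
    (hα : ∀ k j, ∀ a ∈ B j k, ∀ j', ∀ a' ∈ B j' k, α k j a = α k j' a' → j = j' ∧ a = a')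
    (e : Fin v ≃ Fin u × F) :
    IsBNCRDP (m * g * r) (g * r) M v (fun j => K j ∪ (fun k => k - 1) '' K j)
      (fun j i => inflate φ (B j (e i).1) (α (e i).1 j) (e i).2) := by
  rw [isBNCRDP_iff] at hB ⊢
  obtain ⟨hK, hB⟩ := hB
  have hr : 0 < r := NeZero.pos r
  refine ⟨fun j i => ?_, fun j j' => ⟨?_, ?_⟩⟩
  · obtain h | h := card_inflate hφ
      (fun a ha b hb h => (hα (e i).1 j a ha j b hb h).2) (e i).2
    · exact Or.inl (h ▸ hK j _)
    · exact Or.inr ⟨_, hK j _, h.symm⟩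
  · intro i c hc d hd hcd hsub
    obtain ⟨a, ha, hca, x, hx, rfl⟩ := (mem_inflate hφ).1 hc
    obtain ⟨b, hb, hdb, y, hy, rfl⟩ := (mem_inflate hφ).1 hd
    refine (hB j j').1 (e i).1 a ha b hb ?_ ?_
    · rintro rfl rfl
      exact hcd rfl (by rw [Units.ext (hx.trans hy.symm)])
    · have hdiv : m * g * r / (g * r) = m := by
        rw [mul_assoc, Nat.mul_div_cancel _ (Nat.mul_pos hg hr)]
      rw [hdiv] at hsub
      rw [← hca, ← hdb, ← map_sub, Nat.mul_div_cancel _ hg,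
        inSub_castHom_iff _ (dvd_mul_right m g)]
      exact hsub
  · intro i c hc d hd hcd i' c' hc' d' hd' hcd' he
    obtain ⟨a, ha, hca, x, hx, rfl⟩ := (mem_inflate hφ).1 hc
    obtain ⟨b, hb, hdb, y, hy, rfl⟩ := (mem_inflate hφ).1 hd
    obtain ⟨a', ha', hca', x', hx', rfl⟩ := (mem_inflate hφ).1 hc'
    obtain ⟨b', hb', hdb', y', hy', rfl⟩ := (mem_inflate hφ).1 hd'
    have hab : j = j' → a ≠ b := by
      rintro rfl rfl
      exact hcd rfl (by rw [Units.ext (hx.trans hy.symm)])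
    have hab' : j = j' → a' ≠ b' := by
      rintro rfl rfl
      exact hcd' rfl (by rw [Units.ext (hx'.trans hy'.symm)])
    have he' := congrArg (ZMod.castHom (dvd_mul_right (m * g) r) (ZMod (m * g))) he
    rw [map_sub, map_sub, hca, hdb, hca', hdb'] at he'
    obtain ⟨hi, rfl, rfl⟩ := (hB j j').2 (e i).1 a ha b hb hab (e i').1 a' ha' b' hb' hab' he'
    rw [← hi] at hx' hy'
    have hxy : y * x' = y' * x := by
      apply hinj
      rw [hmul, hmul]
      linear_combination he
    have hxy' := congrArg (Units.val) hxy
    rw [Units.val_mul, Units.val_mul, hx, hy, hx', hy'] at hxy'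
    have hne : α (e i).1 j' b - α (e i).1 j a ≠ 0 := fun h0 => by
      obtain ⟨h1, h2⟩ := hα _ _ _ ha _ _ hb (sub_eq_zero.1 h0).symm
      exact hab h1 h2
    have ht : (e i).2 = (e i').2 := mul_left_cancel₀ hne (by linear_combination -hxy')
    have hii : i = i' := e.injective (Prod.ext hi ht)
    subst hii
    rw [Units.ext (hx.trans hx'.symm), Units.ext (hy.trans hy'.symm)]
    exact ⟨rfl, rfl, rfl⟩

/-- An element of `ZMod (n * r)` meets as many inflated block elements in its coset as its
reduction meets original block elements. -/
lemma card_filter_inflate {n d g r u v : ℕ} [NeZero n] [NeZero r] (hn : n = d * g) (hrg : r.Coprime g)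
    {F : Type*} [Field F] (B : Fin u → Finset (ZMod n)) {φ : Fˣ → ZMod (n * r)}
    (hinj : Function.Injective φ)
    (hφ : ∀ z, ZMod.castHom (dvd_mul_right n r) (ZMod n) z = 0 ↔ ∃ x, φ x = z)
    (α : Fin u → ZMod n → F) (e : Fin v ≃ Fin u × F) (x : ZMod (n * r)) :
    ((blockElems (fun i => inflate φ (B (e i).1) (α (e i).1) (e i).2)).filter
      (fun t => inSub (n * r) (d * r) (x - t))).card =
    ((blockElems B).filter (fun t => inSub n d
      (ZMod.castHom (dvd_mul_right n r) (ZMod n) x - t))).card := by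
  subst hn
  have hφ' (x) : ZMod.castHom (dvd_mul_right (d * g) r) (ZMod (d * g)) (φ x) = 0 :=
    (hφ _).2 ⟨x, rfl⟩
  rw [card_filter_blockElems, card_filter_blockElems]
  set π := ZMod.castHom (dvd_mul_right (d * g) r) (ZMod (d * g)) with hπ
  refine Finset.card_bij (fun z _ => ⟨(e z.1).1, π z.2⟩) ?_ ?_ ?_
  · rintro ⟨i, c⟩ hc
    simp only [Finset.mem_filter, Finset.mem_sigma, Finset.mem_univ, true_and] at hc ⊢
    obtain ⟨b, hb, hcb, -⟩ := (mem_inflate hφ').1 hc.1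
    refine ⟨hcb ▸ hb, ?_⟩
    rw [← map_sub, inSub_castHom_iff _ (dvd_mul_right d g)]
    obtain ⟨w, hw⟩ := hc.2
    exact ⟨r * w, by rw [hw]; push_cast; ring⟩
  · rintro ⟨i, c⟩ hc ⟨i', c'⟩ hc' h
    simp only [Finset.mem_filter, Finset.mem_sigma, Finset.mem_univ, true_and] at hc hc'
    simp only [Sigma.mk.injEq, heq_eq_eq] at h
    obtain ⟨hk, hcc⟩ := h
    have hcc' : c = c' := by
      rw [← sub_eq_zero]
      apply eq_zero_of_inSub_of_coprime hrg
      · rw [inSub_iff_castHom_eq_zero (dvd_mul_right (d * g) r), map_sub, sub_eq_zero]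
        exact hcc
      · obtain ⟨w, hw⟩ := hc.2
        obtain ⟨w', hw'⟩ := hc'.2
        exact ⟨w' - w, by linear_combination hw' - hw⟩
    subst hcc'
    obtain ⟨b, hb, hcb, y, hy, hcy⟩ := (mem_inflate hφ').1 hc.1
    obtain ⟨b', hb', hcb', y', hy', hcy'⟩ := (mem_inflate hφ').1 hc'.1
    obtain rfl : b = b' := hcb.symm.trans hcb'
    obtain rfl : y = y' := hinj (add_left_cancel (hcy.symm.trans hcy'))
    rw [← hk] at hy'
    have hii : i = i' := e.injective (Prod.ext hk (add_right_cancel (hy.symm.trans hy')))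
    rw [hii]
  · rintro ⟨k, b⟩ hb
    simp only [Finset.mem_filter, Finset.mem_sigma, Finset.mem_univ, true_and] at hb
    have hπb : π (b.cast : ZMod (d * g * r)) = b := by
      rw [hπ, ← ZMod.natCast_val, map_natCast, ZMod.natCast_val, ZMod.cast_id', id]
    have hsub : inSub (d * g * r) d (x - b.cast) := by
      rw [← inSub_castHom_iff (dvd_mul_right (d * g) r) (dvd_mul_right d g), map_sub, ← hπ, hπb]
      exact hb.2
    obtain ⟨y, hy, hy'⟩ := exists_inSub_sub_of_coprime hrg hsub
    rw [inSub_iff_castHom_eq_zero (dvd_mul_right (d * g) r), hφ] at hy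
    obtain ⟨w, rfl⟩ := hy
    refine ⟨⟨e.symm (k, w - α k b), b.cast + φ w⟩, ?_, ?_⟩
    · simp only [Finset.mem_filter, Finset.mem_sigma, Finset.mem_univ, true_and,
        Equiv.apply_symm_apply]
      refine ⟨(mem_inflate hφ').2 ⟨b, hb.1, castHom_cast_add hφ' b w, w, by simp, rfl⟩, ?_⟩
      rwa [← sub_sub]
    · simp only [Equiv.apply_symm_apply]
      rw [hπ, castHom_cast_add hφ' b w]

theorem stmt12 (m g s M u q : ℕ) (hm : 0 < m) (hg : 0 < g) (hs : 0 < s) (hsg : s ∣ g)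
    (K : Fin M → Set ℕ) (B : Fin M → Fin u → Finset (ZMod (m * g)))
    (hB : IsBNCRDP (m * g) g M u K B)
    (hCSR : ∀ j, IsCSR (m * g) (s * m)
      (blockElems (B j) + (Multiset.range s).map (fun k => ((k * m : ℕ) : ZMod (m * g)))))
    (hq : IsPrimePow q)
    (hqt : ∀ k : Fin u, (∑ j : Fin M, (B j k).card) ≤ q)
    (hgcd : Nat.gcd (q - 1) (g / s) = 1) :
    ∃ K' : Fin M → Set ℕ,
      (∀ j, K' j ⊆ K j ∪ (fun k => k - 1) '' K j) ∧
      ∃ B' : Fin M → Fin (u * q) → Finset (ZMod (m * g * (q - 1))),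
        IsBNCRDP (m * g * (q - 1)) (g * (q - 1)) M (u * q) K' B' ∧
        ∀ j, IsCSR (m * g * (q - 1)) (s * m * (q - 1))
          (blockElems (B' j) +
            (Multiset.range (s * (q - 1))).map
              (fun k => ((k * m : ℕ) : ZMod (m * g * (q - 1))))) := by
  obtain ⟨p, k, hp, hk, rfl⟩ := (isPrimePow_nat_iff q).1 hq
  have := Fact.mk hp
  set q := p ^ k
  have hFq : Nat.card (GaloisField p k) = q := GaloisField.card p k hk.ne'
  have hq1 : 1 < q := hq.one_lt
  obtain ⟨r, hr⟩ : ∃ r, q - 1 = r := ⟨_, rfl⟩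
  have hr0 : NeZero r := ⟨by omega⟩
  have hn0 : NeZero (m * g) := ⟨(Nat.mul_pos hm hg).ne'⟩
  rw [hr] at hgcd ⊢
  obtain ⟨φ, hmul, hinj, hφ⟩ := exists_log (GaloisField p k) (n := m * g) (r := r) (by omega)
  choose α hα using fun i : Fin u =>
    exists_labelling (F := GaloisField p k) (fun j => B j i) ((hqt i).trans hFq.ge)
  let e : Fin (u * q) ≃ Fin u × GaloisField p k :=
    finProdFinEquiv.symm.trans (Equiv.prodCongr (Equiv.refl _) (Finite.equivFinOfCardEq hFq).symm)
  refine ⟨_, fun j => subset_rfl, _,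
    isBNCRDP_inflate hg hB hmul hinj (fun x => (hφ _).2 ⟨x, rfl⟩) α hα e, fun j x => ?_⟩
  obtain ⟨g', rfl⟩ := hsg
  rw [Nat.mul_div_cancel_left _ hs] at hgcd
  have hassoc : m * (s * g') = s * m * g' := by ring
  have hdvd : s * m ∣ m * (s * g') := ⟨g', hassoc⟩
  have hdvd' : s * r * m ∣ m * (s * g') * r := ⟨g', by ring⟩
  have h := hCSR j (ZMod.castHom (dvd_mul_right _ r) _ x)
  rw [Multiset.filter_add, Multiset.card_add] at h ⊢
  rw [card_filter_range_map hs hm hdvd, inSub_castHom_iff _ (dvd_mul_right m _)] at h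
  rw [show s * m * r = s * r * m by ring,
    card_filter_range_map (Nat.mul_pos hs (NeZero.pos r)) hm hdvd']
  rw [show s * r * m = s * m * r by ring]
  refine Eq.trans ?_ h
  congr 1
  exact card_filter_inflate hassoc hgcd (B j) hinj hφ (fun i => α i j) e x
end

section
/- Let p be a prime and let u₁ ≤ u₂ ≤ ⋯ ≤ u_s be positive integers. If p^{u₂} ≥ p^{3u₁+1}u₂, s ≥ 3, p^{u₂} ≥ 2^s and p^{u₁−1} > 5, then there exists a strictly optimal (p·∏_{i=1}^s(p^{u_i}−1), p^{u₁−1}, p; 1 + Σ_{i=1}^s ∏_{j=i}^s p^{u_j})-FHS set; that is, there exists a set S of M = p^{u₁−1} FHSs of length n = p·∏_{i=1}^s(p^{u_i}−1) over an alphabet of size l = 1 + Σ_{i=1}^s ∏_{j=i}^s p^{u_j} such that H(S;L) ≤ ⌈Lp/n⌉ for every L with 1 ≤ L ≤ n, where p = ⌈(2InM−(I+1)Il)/((nM−1)M)⌉ with I = ⌊nM/l⌋. -/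
theorem pengFanBound_eq_s14 {n M l p : ℕ} (hp : 2 ≤ p) (hM : 6 ≤ M)
    (hlt : n * M < p * M * l) (hle : (p * M - 4) * l ≤ n * M) :
    pengFanBound n M l = p := by
  have hq : 12 ≤ p * M := Nat.mul_le_mul hp hM
  have hl : 0 < l := by
    rcases Nat.eq_zero_or_pos l with rfl | h
    · simp at hlt
    · exact h
  unfold pengFanBound
  have hTl := Nat.div_mul_le_self (n * M) l
  have hTl' : n * M < (n * M / l + 1) * l := by
    have := Nat.lt_mul_div_succ (n * M) hl
    rwa [mul_comm l] at this
  have hI : n * M / l < p * M := (Nat.div_lt_iff_lt_mul hl).2 hlt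
  rw [show 2 * (n * M / l) * n * M = 2 * (n * M / l) * (n * M) by ring]
  generalize n * M / l = I at *
  generalize n * M = T at *
  have hT : 8 ≤ T := le_trans (Nat.mul_le_mul (by omega : 8 ≤ p * M - 4) hl) hle
  have hT' : (0 : ℚ) < (T : ℚ) - 1 := by
    have : (8 : ℚ) ≤ T := by exact_mod_cast hT
    linarith
  have hM' : (0 : ℚ) < M := by exact_mod_cast (by omega : 0 < M)
  rw [Int.ceil_eq_iff, lt_div_iff₀ (mul_pos hT' hM'), div_le_iff₀ (mul_pos hT' hM')]
  have hqz : (12 : ℤ) ≤ p * M := by exact_mod_cast hq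
  have hlz : (0 : ℤ) < l := by exact_mod_cast hl
  have hMz : (6 : ℤ) ≤ M := by exact_mod_cast hM
  have hTz : (8 : ℤ) ≤ T := by exact_mod_cast hT
  have hIz : (I : ℤ) + 1 ≤ p * M := by exact_mod_cast hI
  have hTlz : (I : ℤ) * l ≤ T := by exact_mod_cast hTl
  have hTlz' : (T : ℤ) + 1 ≤ (I + 1) * l := by exact_mod_cast hTl'
  have hlez : ((p : ℤ) * M - 4) * l ≤ T := by
    zify [show 4 ≤ p * M by omega] at hle
    exact hle
  constructor
  · have hmax : ((p : ℤ) * M - 2) * (2 * T - (p * M - 1) * l) ≤ I * (2 * T - (I + 1) * l) := by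
      suffices 0 ≤ ((I : ℤ) - (p * M - 2)) * (2 * T - (I + p * M - 1) * l) by nlinarith
      rcases lt_trichotomy (I : ℤ) (p * M - 2) with h | h | h
      · refine mul_nonneg_of_nonpos_of_nonpos (by linarith) ?_
        nlinarith [mul_nonneg (by linarith : (0 : ℤ) ≤ p * M - 2 - I - 1) hlz.le]
      · rw [h]; simp
      · refine mul_nonneg (by linarith) ?_
        nlinarith [mul_nonneg (by linarith : (0 : ℤ) ≤ I - (p * M - 2) - 1) hlz.le]
    have hlarge : ((p : ℤ) * M - 6) * T ≤ (p * M - 2) * (2 * T - (p * M - 1) * l) := by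
      nlinarith [mul_le_mul_of_nonneg_left hlez (by linarith : (0 : ℤ) ≤ p * M + 2),
        mul_nonneg hlz.le (by linarith : (0 : ℤ) ≤ p * M - 10)]
    have hlow : ((p : ℤ) - 1) * ((T - 1) * M) < 2 * I * T - (I + 1) * I * l := by
      nlinarith [mul_nonneg (by linarith : (0 : ℤ) ≤ M - 6) (by linarith : (0 : ℤ) ≤ T)]
    exact_mod_cast hlow
  · have hup : 2 * (I : ℤ) * T - (I + 1) * I * l ≤ p * ((T - 1) * M) := by
      nlinarith [mul_nonneg (by positivity : (0 : ℤ) ≤ I)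
        (by linarith : (0 : ℤ) ≤ (I + 1) * l - T - 1),
        mul_nonneg (by linarith : (0 : ℤ) ≤ p * M - I) (by linarith : (0 : ℤ) ≤ T - 1)]
    exact_mod_cast hup

theorem sub_mul_prod_le {r : ℕ} (q : ℤ) (hq : 1 ≤ q) (v : Fin r → ℤ) (hv : ∀ i, q ≤ v i) :
    (q - r) * ∏ i, v i ≤ q * ∏ i, (v i - 1) := by
  induction r with
  | zero => simp
  | succ r ih =>
    rw [Fin.prod_univ_succ, Fin.prod_univ_succ]
    have h := ih (fun i => v i.succ) fun i => hv _
    have h0 := hv 0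
    have hP : 0 ≤ ∏ i : Fin r, v i.succ := Finset.prod_nonneg fun i _ => by linarith [hv i.succ]
    push_cast
    nlinarith [mul_le_mul_of_nonneg_left h (by linarith : 0 ≤ v 0 - 1),
      mul_nonneg hP (by linarith [Int.natCast_nonneg r] : 0 ≤ v 0 - q + r)]

theorem sq_le_two_mul_two_pow (s : ℕ) : s * s ≤ 2 * 2 ^ s := by
  by_cases h : s < 3
  · interval_cases s <;> norm_num
  · induction s, (not_lt.1 h) using Nat.le_induction with
    | base => norm_num
    | succ s hs ih =>
      have := ih (by omega)
      by_cases h4 : s = 3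
      · subst h4; norm_num
      · rw [pow_succ]; nlinarith [show 4 ≤ s by omega]

theorem mul_succ_le_two_mul {q Q s : ℕ} (hq : 6 ≤ q) (hQ : q ^ 3 ≤ Q) (hs : 2 ^ s ≤ Q) :
    s * (q + 1) ≤ 2 * Q := by
  rcases le_or_gt (q + 1) s with h | h
  · nlinarith [sq_le_two_mul_two_pow s]
  · nlinarith [mul_le_mul hq hq (by norm_num) (by omega)]

theorem sub_four_mul_alphabet_le {r : ℕ} (v : Fin (r + 2) → ℕ) (h0 : 6 ≤ v 0)
    (hv : ∀ i : Fin r, v 1 ≤ v i.succ.succ) (hr : (r + 1) * (v 0 + 1) ≤ 2 * v 1) :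
    (v 0 - 4) * (1 + ∑ i, ∏ j, if i ≤ j then v j else 1) ≤ v 0 * ∏ i, (v i - 1) := by
  have h1 : 1 ≤ v 1 := by nlinarith
  have hv1 : ∀ i : Fin r, 1 ≤ v i.succ.succ := fun i => h1.trans (hv i)
  have hR : 1 ≤ ∏ i : Fin r, v i.succ.succ := Nat.one_le_iff_ne_zero.2
    (Finset.prod_ne_zero_iff.2 fun i _ => by have := hv1 i; omega)
  have hb := sub_mul_prod_le (v 1 : ℤ) (by exact_mod_cast h1) (fun i : Fin r => (v i.succ.succ : ℤ))
    fun i => by exact_mod_cast hv i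
  have hsum : (∑ i : Fin r, ∏ j : Fin r, if i ≤ j then v j.succ.succ else 1) ≤
      r * ∏ i : Fin r, v i.succ.succ := by
    calc _ ≤ ∑ _i : Fin r, ∏ i : Fin r, v i.succ.succ := by
          refine Finset.sum_le_sum fun i _ => Finset.prod_le_prod' fun j _ => ?_
          split_ifs
          · exact le_rfl
          · exact hv1 j
      _ = _ := by simp
  simp only [Fin.sum_univ_succ, Fin.prod_univ_succ, Fin.succ_le_succ_iff, Fin.zero_le, if_true,
    Fin.le_zero_iff, Fin.succ_ne_zero, if_false, one_mul]
  simp only [Fin.succ_zero_eq_one]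
  have hc : ((∏ i : Fin r, (v i.succ.succ - 1) : ℕ) : ℤ) = ∏ i : Fin r, ((v i.succ.succ : ℤ) - 1) := by
    push_cast
    exact Finset.prod_congr rfl fun i _ => by rw [Nat.cast_sub (hv1 i), Nat.cast_one]
  rw [← hc, ← Nat.cast_prod] at hb
  generalize (∏ i : Fin r, (v i.succ.succ - 1)) = R' at *
  generalize (∏ i : Fin r, v i.succ.succ) = R at *
  generalize (∑ i : Fin r, ∏ j : Fin r, if i ≤ j then v j.succ.succ else 1) = S at *
  generalize v 0 = q at *
  generalize v 1 = Q at *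
  have hQ : (1 : ℤ) ≤ Q := by exact_mod_cast h1
  zify [show 4 ≤ q by omega, show 1 ≤ q by omega, h1] at *
  have hR' : ((Q : ℤ) - (r + 1)) * R ≤ (Q - 1) * R' := by
    refine le_of_mul_le_mul_left ?_ (by linarith : 0 < (Q : ℤ))
    nlinarith [mul_le_mul_of_nonneg_left hb (by linarith : 0 ≤ (Q : ℤ) - 1)]
  calc ((q : ℤ) - 4) * (1 + (q * (Q * R) + (Q * R + S)))
      ≤ (q - 4) * ((q * Q + Q + (r + 1)) * R) :=
        mul_le_mul_of_nonneg_left (by linarith) (by linarith)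
    _ ≤ q * (q - 1) * ((Q - (r + 1)) * R) := by
        suffices 0 ≤ ((q : ℤ) + 2) * (2 * Q - (r + 1) * (q - 2)) * R by nlinarith
        refine mul_nonneg (mul_nonneg (by linarith) (by nlinarith)) (by linarith)
    _ ≤ q * (q - 1) * ((Q - 1) * R') :=
        mul_le_mul_of_nonneg_left hR' (mul_nonneg (by linarith) (by linarith))
    _ = _ := by ring

theorem card_le_ceil_of_dvd_sub {n N lam : ℕ} (hN : 0 < N) (hlam : 0 < lam) (hn : n = lam * N)
    (P : ℕ → Prop) [DecidablePred P] (hP : ∀ t d, P t → P (t + d) → N ∣ d) {L : ℕ} (hL : 1 ≤ L) :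
    (((∑ t ∈ Finset.range L, if P t then 1 else 0 : ℕ) : ℤ)) ≤
      ⌈((L * lam : ℕ) : ℚ) / (n : ℚ)⌉ := by
  have hcard : (∑ t ∈ Finset.range L, if P t then 1 else 0) ≤ (L - 1) / N + 1 := by
    rw [← Finset.card_filter, ← Finset.card_range ((L - 1) / N + 1)]
    refine Finset.card_le_card_of_injOn (· / N) ?_ ?_
    · intro t ht
      simp only [Finset.coe_filter, Finset.mem_range, Set.mem_ofPred_eq] at ht
      simp only [Finset.coe_range, Set.mem_Iio]
      exact Nat.lt_succ_of_le (Nat.div_le_div_right (by omega))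
    · have key : ∀ t t', P t → P t' → t ≤ t' → t / N = t' / N → t = t' := by
        intro t t' ht ht' hle h
        obtain ⟨d, rfl⟩ := Nat.exists_eq_add_of_le hle
        obtain ⟨e, rfl⟩ := hP t d ht ht'
        rw [Nat.add_mul_div_left _ _ hN] at h
        simp [show e = 0 by omega]
      intro t ht t' ht' h
      simp only [Finset.coe_filter, Set.mem_ofPred_eq] at ht ht'
      rcases le_total t t' with hle | hle
      · exact key t t' ht.2 ht'.2 hle h
      · exact (key t' t ht'.2 ht.2 hle h.symm).symm
  have hdiv : (((L - 1) / N : ℕ) : ℤ) < ⌈((L * lam : ℕ) : ℚ) / (n : ℚ)⌉ := by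
    rw [Int.lt_ceil, hn]
    have hN' : (0 : ℚ) < N := by exact_mod_cast hN
    have hlam' : (0 : ℚ) < lam := by exact_mod_cast hlam
    push_cast
    rw [mul_comm (L : ℚ), mul_div_mul_left _ _ hlam'.ne', lt_div_iff₀ hN']
    have : (L - 1) / N * N < L := by
      have := Nat.div_mul_le_self (L - 1) N
      omega
    exact_mod_cast this
  have : ((∑ t ∈ Finset.range L, if P t then 1 else 0 : ℕ) : ℤ) ≤ (((L - 1) / N + 1 : ℕ) : ℤ) := by
    exact_mod_cast hcard
  push_cast at *
  linarith

theorem modEq_prod_range_of_digits (r : ℕ → ℕ) {k t t' : ℕ}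
    (h : ∀ i < k, t / (∏ j ∈ Finset.range i, r j) ≡ t' / (∏ j ∈ Finset.range i, r j) [MOD r i]) :
    t ≡ t' [MOD ∏ j ∈ Finset.range k, r j] := by
  induction k with
  | zero => simp [Nat.modEq_one]
  | succ k ih =>
    have h1 := ih fun i hi => h i (by omega)
    have h2 := h k (by omega)
    rw [Finset.prod_range_succ]
    unfold Nat.ModEq at *
    rw [Nat.mod_mul, Nat.mod_mul, h1, h2]

theorem exists_dvd_prod_range_not_dvd_succ (r : ℕ → ℕ) {k d : ℕ}
    (h : ¬ (∏ j ∈ Finset.range k, r j) ∣ d) :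
    ∃ i < k, (∏ j ∈ Finset.range i, r j) ∣ d ∧ ¬ (∏ j ∈ Finset.range (i + 1), r j) ∣ d := by
  induction k with
  | zero => simp at h
  | succ k ih =>
    by_cases hk : (∏ j ∈ Finset.range k, r j) ∣ d
    · exact ⟨k, by omega, hk, h⟩
    · obtain ⟨i, hi, h'⟩ := ih hk
      exact ⟨i, by omega, h'⟩

section Construction

variable {p s : ℕ} {A : Type*} [AddCommGroup A] {F : Fin s → Type*} [∀ i, Field (F i)]

/-- The `i`-th coordinate at time `t` is `α i` to the power of the mixed-radix digit of `t` with
radices `r`, plus the image under `ψ i` of the label `(a, t mod p)`. -/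
def digitSeq (r : ℕ → ℕ) (α : ∀ i, F i) (ψ : ∀ i, A × ZMod p →+ F i) (a : A) (t : ℕ) :
    ∀ i, F i :=
  fun i => α i ^ (t / ∏ j ∈ Finset.range i, r j) + ψ i (a, (t : ZMod p))

variable {r : ℕ → ℕ} {α : ∀ i, F i} {ψ : ∀ i, A × ZMod p →+ F i}

theorem digitSeq_periodic (hr : ∀ i, 0 < r i) (hα : ∀ i : Fin s, orderOf (α i) = r i) (a : A) :
    Function.Periodic (digitSeq r α ψ a) (p * ∏ j ∈ Finset.range s, r j) := by
  intro t
  funext i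
  have hW : 0 < ∏ j ∈ Finset.range i, r j := Finset.prod_pos fun j _ => hr j
  obtain ⟨c, hc⟩ := Finset.prod_dvd_prod_of_subset (Finset.range (i + 1)) (Finset.range s) r
    (Finset.range_subset_range.2 i.2)
  rw [Finset.prod_range_succ] at hc
  simp only [digitSeq]
  rw [show t + p * ∏ j ∈ Finset.range s, r j =
    t + (∏ j ∈ Finset.range i, r j) * (r i * (p * c)) by rw [hc]; ring,
    Nat.add_mul_div_left _ _ hW, pow_add, pow_mul, ← hα i, pow_orderOf_eq_one, one_pow, mul_one,
    hα i]
  congr 3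
  rw [show (∏ j ∈ Finset.range i, r j) * (r i * (p * c)) =
    p * ((∏ j ∈ Finset.range i, r j) * r i * c) by ring]
  simp

/-- Two equal symbols followed at the same distance `d` by two equal symbols can only come from
the same place, unless `d` is a multiple of the product of the radices. -/
theorem eq_and_modEq_of_digitSeq_eq (hr : ∀ i, 0 < r i)
    (hcop : ∀ i, Nat.Coprime p (r i)) (hα : ∀ i : Fin s, orderOf (α i) = r i)
    (hψ : ∀ i, Function.Injective (ψ i)) {a a' : A} {t t' d : ℕ}
    (hd : ¬ (∏ j ∈ Finset.range s, r j) ∣ d)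
    (h : digitSeq r α ψ a t = digitSeq r α ψ a' t')
    (h' : digitSeq r α ψ a (t + d) = digitSeq r α ψ a' (t' + d)) :
    a = a' ∧ t ≡ t' [MOD p * ∏ j ∈ Finset.range s, r j] := by
  obtain ⟨i, hi, ⟨e, rfl⟩, hne⟩ := exists_dvd_prod_range_not_dvd_succ r hd
  have hW : 0 < ∏ j ∈ Finset.range i, r j := Finset.prod_pos fun j _ => hr j
  have hlabel : (a, (t : ZMod p)) = (a', (t' : ZMod p)) := by
    have h1 := congrFun h ⟨i, hi⟩
    have h2 := congrFun h' ⟨i, hi⟩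
    simp only [digitSeq, Nat.add_mul_div_left _ _ hW, pow_add] at h1 h2
    have hadd : ∀ (b : A) (m : ℕ), ψ ⟨i, hi⟩ (b, ((m + (∏ j ∈ Finset.range i, r j) * e : ℕ) : ZMod p))
        = ψ ⟨i, hi⟩ (b, (m : ZMod p)) +
          ψ ⟨i, hi⟩ (0, (((∏ j ∈ Finset.range i, r j) * e : ℕ) : ZMod p)) := by
      intro b m
      rw [← map_add]
      simp
    rw [hadd, hadd] at h2
    have hα1 : α ⟨i, hi⟩ ^ e ≠ 1 := by
      intro h1
      have := orderOf_dvd_of_pow_eq_one h1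
      rw [hα] at this
      rw [Finset.prod_range_succ] at hne
      exact hne (Nat.mul_dvd_mul_left _ this)
    have hpow : (α ⟨i, hi⟩ ^ e - 1) * (α ⟨i, hi⟩ ^ (t / ∏ j ∈ Finset.range i, r j) -
        α ⟨i, hi⟩ ^ (t' / ∏ j ∈ Finset.range i, r j)) = 0 := by
      linear_combination h2 - h1
    have hpow' := sub_eq_zero.1 ((mul_eq_zero.1 hpow).resolve_left (sub_ne_zero.2 hα1))
    rw [hpow'] at h1
    exact hψ _ (add_left_cancel h1)
  obtain ⟨rfl, ht⟩ := Prod.mk.inj hlabel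
  refine ⟨rfl, ?_⟩
  rw [← Nat.modEq_and_modEq_iff_modEq_mul (Nat.Coprime.prod_right fun i _ => hcop i)]
  refine ⟨(ZMod.natCast_eq_natCast_iff _ _ _).1 ht, modEq_prod_range_of_digits r fun k hk => ?_⟩
  have h1 := congrFun h ⟨k, hk⟩
  simp only [digitSeq, ht] at h1
  have hu : IsUnit (α ⟨k, hk⟩) :=
    (orderOf_pos_iff.1 ((hα ⟨k, hk⟩).symm ▸ hr k)).isUnit
  have := hα ⟨k, hk⟩
  rw [← hu.unit_spec, orderOf_units] at this
  rw [← this]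
  refine pow_eq_pow_iff_modEq.1 (Units.ext ?_)
  simpa using add_right_cancel h1

/-- The sequences `digitSeq` form an FHS set whose partial Hamming correlation over a window of
length `L` is at most `⌈L * p / n⌉`. -/
theorem exists_fhsSet {n M l : ℕ} (hp : 0 < p) (hr : ∀ i, 0 < r i)
    (hcop : ∀ i, Nat.Coprime p (r i)) (hα : ∀ i : Fin s, orderOf (α i) = r i)
    (hψ : ∀ i, Function.Injective (ψ i)) (hn : n = p * ∏ j ∈ Finset.range s, r j)
    (hN : ∏ j ∈ Finset.range s, r j ≠ 1) (f : Fin M ↪ A) (g : (∀ i, F i) ↪ Fin l) :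
    ∃ X : Fin M → (ZMod n → Fin l),
      (∀ a b : Fin M, a ≠ b → X a ≠ X b) ∧
      ∀ L : ℕ, 1 ≤ L → L ≤ n →
        (∀ a : Fin M, ∀ τ : ZMod n, τ ≠ 0 → ∀ j : ZMod n,
          (partialHC (X a) (X a) τ j L : ℤ) ≤ ⌈((L * p : ℕ) : ℚ) / (n : ℚ)⌉) ∧
        (∀ a b : Fin M, a ≠ b → ∀ τ j : ZMod n,
          (partialHC (X a) (X b) τ j L : ℤ) ≤ ⌈((L * p : ℕ) : ℚ) / (n : ℚ)⌉) := by
  have hN0 : 0 < ∏ j ∈ Finset.range s, r j := Finset.prod_pos fun j _ => hr j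
  have : NeZero n := ⟨by rw [hn]; positivity⟩
  have hX : ∀ (a : A) (t : ℕ),
      digitSeq r α ψ a (t : ZMod n).val = digitSeq r α ψ a t := fun a t => by
    rw [ZMod.val_natCast, hn]
    exact (digitSeq_periodic hr hα a).map_mod_nat t
  have hcorr : ∀ a b : Fin M, ∀ τ : ZMod n, (a = b → τ ≠ 0) → ∀ (j : ZMod n) (L : ℕ), 1 ≤ L →
      (partialHC (fun t => g (digitSeq r α ψ (f a) t.val)) (fun t => g (digitSeq r α ψ (f b) t.val))
        τ j L : ℤ) ≤ ⌈((L * p : ℕ) : ℚ) / (n : ℚ)⌉ := by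
    intro a b τ hτ j L hL
    refine card_le_ceil_of_dvd_sub hN0 hp hn _ (fun t d h h' => ?_) hL
    by_contra hd
    have hj : ∀ x : ℕ, j + (x : ZMod n) = ((j.val + x : ℕ) : ZMod n) := fun x => by simp
    have hjτ : ∀ x : ℕ, j + (x : ZMod n) + τ = ((j.val + τ.val + x : ℕ) : ZMod n) := fun x => by
      simp; ring
    rw [hjτ, hj, EmbeddingLike.apply_eq_iff_eq, hX, hX] at h h'
    rw [← add_assoc, ← add_assoc] at h'
    obtain ⟨hab, hmod⟩ := eq_and_modEq_of_digitSeq_eq hr hcop hα hψ hd h h'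
    refine hτ (f.injective hab) ?_
    rw [← hn, ← ZMod.natCast_eq_natCast_iff] at hmod
    simpa using hmod.symm
  refine ⟨fun a t => g (digitSeq r α ψ (f a) t.val), fun a b hab h => hab ?_, fun L hL _ =>
    ⟨fun a τ hτ j => hcorr a a τ (fun _ => hτ) j L hL,
      fun a b hab τ j => hcorr a b τ (fun h => (hab h).elim) j L hL⟩⟩
  have heq : ∀ t : ℕ, digitSeq r α ψ (f a) t = digitSeq r α ψ (f b) t := fun t => by
    rw [← hX (f a), ← hX (f b)]
    exact g.injective (congrFun h (t : ZMod n))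
  exact f.injective (eq_and_modEq_of_digitSeq_eq hr hcop hα hψ
    (by rwa [Nat.dvd_one]) (heq 0) (heq (0 + 1))).1

end Construction

theorem exists_orderOf_eq_card_sub_one (K : Type*) [Field K] [Finite K] :
    ∃ α : K, orderOf α = Nat.card K - 1 := by
  obtain ⟨g, hg⟩ := IsCyclic.exists_ofOrder_eq_natCard (α := Kˣ)
  exact ⟨g, by rw [orderOf_units, hg, Nat.card_units]⟩

theorem exists_addMonoidHom_injective_galoisField (p : ℕ) [Fact p.Prime] {k m : ℕ} (h : k + 1 ≤ m) :
    ∃ ψ : (Fin k → ZMod p) × ZMod p →+ GaloisField p m, Function.Injective ψ := by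
  obtain ⟨f, hf⟩ := (finrank_le_iff_exists_linearMap (R := ZMod p)
    (M := (Fin k → ZMod p) × ZMod p) (M' := GaloisField p m)).1 (by
      rw [GaloisField.finrank p (by omega)]
      simpa using h)
  exact ⟨f.toAddMonoidHom, hf⟩

theorem stmt14 (p s : ℕ) (hp : p.Prime) (hs : 3 ≤ s)
    (u : Fin s → ℕ) (hu : ∀ i, 0 < u i) (hmono : Monotone u)
    (h1 : p ^ (3 * u ⟨0, by omega⟩ + 1) * u ⟨1, by omega⟩ ≤ p ^ u ⟨1, by omega⟩)
    (h2 : 2 ^ s ≤ p ^ u ⟨1, by omega⟩)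
    (h3 : 5 < p ^ (u ⟨0, by omega⟩ - 1)) :
    IsStrictlyOptimalFHSSet (p * ∏ i : Fin s, (p ^ u i - 1)) (p ^ (u ⟨0, by omega⟩ - 1)) p
      (1 + ∑ i : Fin s, ∏ j : Fin s, if i ≤ j then p ^ u j else 1) := by
  have : Fact p.Prime := ⟨hp⟩
  obtain ⟨r, rfl⟩ : ∃ r, s = r + 2 := ⟨s - 2, by omega⟩
  simp only [Fin.mk_zero', Fin.mk_one] at h1 h2 h3 ⊢
  have hu0 : p ^ u 0 = p * p ^ (u 0 - 1) := by rw [← pow_succ', Nat.sub_add_cancel (hu 0)]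
  have hpp := hp.two_le
  have hq : 12 ≤ p ^ u 0 := hu0 ▸ Nat.mul_le_mul hpp h3
  have hge : ∀ i, p ^ u 0 ≤ p ^ u i := fun i => Nat.pow_le_pow_right hp.pos (hmono (Fin.zero_le i))
  have hpos : ∀ i, 0 < p ^ u i - 1 := fun i => by have := hge i; omega
  have hcube : (p ^ u 0) ^ 3 ≤ p ^ u 1 := by
    refine le_trans ?_ h1
    rw [← pow_mul, mul_comm (u 0)]
    exact (Nat.pow_le_pow_right hp.pos (by omega)).trans (Nat.le_mul_of_pos_right _ (hu 1))
  have hPl : ∏ i, p ^ u i ≤ 1 + ∑ i, ∏ j, if i ≤ j then p ^ u j else 1 := by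
    have := Finset.single_le_sum (f := fun i : Fin (r + 2) => ∏ j, if i ≤ j then p ^ u j else 1)
      (fun i _ => Nat.zero_le _) (Finset.mem_univ 0)
    simp only [Fin.zero_le, if_true] at this
    omega
  have hnM : (p * ∏ i, (p ^ u i - 1)) * p ^ (u 0 - 1) = p ^ u 0 * ∏ i, (p ^ u i - 1) := by
    rw [hu0]; ring
  refine ⟨(pengFanBound_eq_s14 hpp h3 ?_ ?_).symm, ?_⟩
  · rw [hnM, ← hu0]
    refine Nat.mul_lt_mul_of_pos_left (lt_of_lt_of_le ?_ hPl) (by omega)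
    refine Finset.prod_lt_prod_of_nonempty (fun i _ => hpos i) (fun i _ => ?_) Finset.univ_nonempty
    have := hpos i; omega
  · rw [hnM, ← hu0]
    refine sub_four_mul_alphabet_le (fun i => p ^ u i) (by omega) (fun i => ?_) ?_
    · exact Nat.pow_le_pow_right hp.pos (hmono (Fin.le_def.2 (by simp)))
    · refine le_trans (Nat.mul_le_mul_right _ (by omega))
        (mul_succ_le_two_mul (s := r + 2) (by omega) hcube h2)
  · choose α hα using fun i => exists_orderOf_eq_card_sub_one (GaloisField p (u i))
    choose ψ hψ using fun i : Fin (r + 2) => exists_addMonoidHom_injective_galoisField p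
      (k := u 0 - 1) (m := u i) (by have := hmono (Fin.zero_le i); have := hu 0; omega)
    have hprod : ∏ i, (p ^ u i - 1) =
        ∏ j ∈ Finset.range (r + 2), if h : j < r + 2 then p ^ u ⟨j, h⟩ - 1 else 1 := by
      rw [Finset.prod_range]; simp
    have : ∀ i, Fintype (GaloisField p (u i)) := fun i => Fintype.ofFinite _
    have hg : Nonempty ((∀ i, GaloisField p (u i)) ↪
        Fin (1 + ∑ i, ∏ j, if i ≤ j then p ^ u j else 1)) :=
      Function.Embedding.nonempty_of_card_le (by
        rw [Fintype.card_fin, ← Nat.card_eq_fintype_card, Nat.card_pi]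
        simpa only [GaloisField.card p _ (hu _).ne'] using hPl)
    have hf : Nonempty (Fin (p ^ (u 0 - 1)) ↪ (Fin (u 0 - 1) → ZMod p)) :=
      Function.Embedding.nonempty_of_card_le (by simp [ZMod.card])
    refine exists_fhsSet hp.pos (fun i => ?_) (fun i => ?_) (fun i => ?_) hψ
      (by rw [hprod]) ?_ hf.some hg.some (α := α)
    · split_ifs
      exacts [hpos _, one_pos]
    · split_ifs
      · refine (hp.coprime_iff_not_dvd).2 fun hdvd => hp.one_lt.ne' (Nat.dvd_one.1 ?_)
        have := Nat.dvd_sub (dvd_pow_self p (hu ⟨i, ‹_›⟩).ne') hdvd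
        rwa [Nat.sub_sub_self (Nat.one_le_pow _ _ hp.pos)] at this
      · simp
    · simp only [hα, GaloisField.card p _ (hu _).ne', Fin.is_lt, dif_pos]
    · rw [← hprod]
      intro h
      have := Nat.eq_one_of_mul_eq_one_right (by rw [Fin.prod_univ_succ] at h; exact h)
      omega
end
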